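/- arXiv:0706.1536 — 8 statements merged into one kernel-verified Lean document; each statement's English description precedes it below -/
import Mathlib

section
/- Let X, Y be k×k complex matrices and let A be the 2k×2k block matrix A = [[I_k, X], [Y, −I_k]]. Then there is a unitary matrix U ∈ M_{2k}(ℂ) such that U*AU has the k×k zero matrix as its leading principal k×k submatrix. -/
open Matrix

theorem apply_eq_zero_of_pow_sub_apply_eq_zero {V : Type*} [AddCommGroup V] [Module ℂ V]
    (h : V →ₗ⋆[ℂ] V →ₗ[ℂ] ℂ) (T : Module.End ℂ V) (hT : ∀ u v, h (T u) v + h u (T v) = 0)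
    {a b : ℂ} (hab : star a + b ≠ 0) (m n : ℕ) (u v : V)
    (hu : ((T - a • (1 : Module.End ℂ V)) ^ m) u = 0)
    (hv : ((T - b • (1 : Module.End ℂ V)) ^ n) v = 0) :
    h u v = 0 := by
  induction m generalizing u v n with
  | zero => simp_all
  | succ m ihm =>
    induction n generalizing v with
    | zero => simp_all
    | succ n ihn =>
      have h1 := ihm (n + 1) ((T - a • (1 : Module.End ℂ V)) u) v (by rwa [pow_succ] at hu) hv
      have h2 := ihn ((T - b • (1 : Module.End ℂ V)) v) (by rwa [pow_succ] at hv)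
      simp at h1 h2
      have h3 := hT u v
      refine (mul_eq_zero.1 (?_ : (star a + b) * h u v = 0)).resolve_left hab
      simp only [Complex.star_def]
      linear_combination h3 - h1 - h2

theorem exists_isotropic_sup_eq_top {V : Type*} [AddCommGroup V] [Module ℂ V]
    [FiniteDimensional ℂ V]
    (h : V →ₗ⋆[ℂ] V →ₗ[ℂ] ℂ) (T : Module.End ℂ V) (hT : ∀ u v, h (T u) v + h u (T v) = 0)
    (hre : ∀ (a : ℂ) (v : V), T v = a • v → a.re = 0 → v = 0) :
    ∃ P Q : Submodule ℂ V, P ⊔ Q = ⊤ ∧ (∀ u ∈ P, ∀ v ∈ P, h u v = 0 ∧ h u (T v) = 0) ∧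
      ∀ u ∈ Q, ∀ v ∈ Q, h u v = 0 := by
  have key : ∀ p : ℂ → Prop, (∀ a b, p a → p b → star a + b ≠ 0) →
      ∀ u ∈ ⨆ (a : ℂ) (_ : p a), T.maxGenEigenspace a,
      ∀ v ∈ ⨆ (a : ℂ) (_ : p a), T.maxGenEigenspace a, h u v = 0 := by
    intro p hp u hu v hv
    have h1 : (⨆ (a : ℂ) (_ : p a), T.maxGenEigenspace a) ≤ LinearMap.ker (h.flip v) := by
      refine iSup₂_le fun a ha x hx => ?_
      have h2 : (⨆ (a : ℂ) (_ : p a), T.maxGenEigenspace a) ≤ LinearMap.ker (h x) := by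
        refine iSup₂_le fun b hb y hy => ?_
        obtain ⟨m, hm⟩ := (T.mem_maxGenEigenspace a x).1 hx
        obtain ⟨n, hn⟩ := (T.mem_maxGenEigenspace b y).1 hy
        exact apply_eq_zero_of_pow_sub_apply_eq_zero h T hT (hp a b ha hb) m n x y hm hn
      exact h2 hv
    exact h1 hu
  refine ⟨⨆ (a : ℂ) (_ : 0 < a.re), T.maxGenEigenspace a,
    ⨆ (a : ℂ) (_ : a.re < 0), T.maxGenEigenspace a, ?_, ?_, ?_⟩
  · rw [eq_top_iff, ← T.iSup_maxGenEigenspace_eq_top]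
    refine iSup_le fun a => ?_
    rcases lt_trichotomy a.re 0 with ha | ha | ha
    · exact le_sup_of_le_right (le_iSup₂_of_le a ha le_rfl)
    · intro v hv
      obtain ⟨m, hm⟩ := (T.mem_maxGenEigenspace a v).1 hv
      have hpow : ∀ (m : ℕ) (v : V), ((T - a • (1 : Module.End ℂ V)) ^ m) v = 0 → v = 0 := by
        intro m
        induction m with
        | zero => simp
        | succ m ih =>
          intro v hm
          have := ih ((T - a • (1 : Module.End ℂ V)) v) (by rwa [pow_succ] at hm)
          exact hre a v (by simpa [sub_eq_zero] using this) ha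
      simp [hpow m v hm]
    · exact le_sup_of_le_left (le_iSup₂_of_le a ha le_rfl)
  · have hp := key (fun a => 0 < a.re) (fun a b ha hb h0 => by
      have := congrArg Complex.re h0
      simp at this
      linarith)
    refine fun u hu v hv => ⟨hp u hu v hv, hp u hu (T v) ?_⟩
    have h2 : (⨆ (a : ℂ) (_ : 0 < a.re), T.maxGenEigenspace a) ≤
        (⨆ (a : ℂ) (_ : 0 < a.re), T.maxGenEigenspace a).comap T :=
      iSup₂_le fun a ha x hx => le_iSup₂ (f := fun (a : ℂ) (_ : 0 < a.re) => T.maxGenEigenspace a)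
        a ha (T.mapsTo_maxGenEigenspace_of_comm rfl a hx)
    exact h2 hv
  · exact key (fun a => a.re < 0) (fun a b ha hb h0 => by
      have := congrArg Complex.re h0
      simp at this
      linarith)

theorem exists_unitary_zero_block_of_submodule {k : ℕ}
    (A : Matrix (Fin k ⊕ Fin k) (Fin k ⊕ Fin k) ℂ) (S : Submodule ℂ (Fin k ⊕ Fin k → ℂ))
    (hS : Module.finrank ℂ S = k) (hA : ∀ u ∈ S, ∀ v ∈ S, star u ⬝ᵥ A *ᵥ v = 0) :
    ∃ U : Matrix (Fin k ⊕ Fin k) (Fin k ⊕ Fin k) ℂ, Uᴴ * U = 1 ∧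
      (Uᴴ * A * U).toBlocks₁₁ = 0 := by
  let e := WithLp.linearEquiv 2 ℂ (Fin k ⊕ Fin k → ℂ)
  let S' : Submodule ℂ (EuclideanSpace ℂ (Fin k ⊕ Fin k)) := S.comap e.toLinearMap
  have hS' : Module.finrank ℂ S' = k := by
    refine (e.submoduleMap S').finrank_eq.trans ?_
    rw [Submodule.map_comap_eq_of_surjective e.surjective, hS]
  let b := (stdOrthonormalBasis ℂ S').reindex (finCongr hS')
  let w : Fin k ⊕ Fin k → EuclideanSpace ℂ (Fin k ⊕ Fin k) :=
    Sum.elim (fun i => (b i : EuclideanSpace ℂ (Fin k ⊕ Fin k))) 0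
  have hw : Orthonormal ℂ ((Set.range Sum.inl).domRestrict w) := by
    rw [orthonormal_iff_ite]
    rintro ⟨_, i, rfl⟩ ⟨_, j, rfl⟩
    have := orthonormal_iff_ite.1 b.orthonormal i j
    simpa [w, Set.domRestrict, Subtype.ext_iff] using this
  obtain ⟨c, hc⟩ := hw.exists_orthonormalBasis_extension_of_card_eq (by simp)
  refine ⟨of fun i j => c j i, ?_, ?_⟩
  · ext i j
    have := orthonormal_iff_ite.1 c.orthonormal i j
    simp only [PiLp.inner_apply, RCLike.inner_apply] at this
    simp [Matrix.mul_apply, Matrix.one_apply, ← this, mul_comm]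
  · ext i j
    have hm : ∀ i, (fun l => c (Sum.inl i) l) ∈ S := fun i => by
      have := (b i).2
      rw [hc _ ⟨i, rfl⟩]
      exact this
    refine Eq.trans ?_ (hA _ (hm i) _ (hm j))
    rw [Matrix.mul_assoc]
    simp [toBlocks₁₁, Matrix.mul_apply, dotProduct, mulVec]

theorem star_dotProduct_conjTranspose_mulVec {n : Type*} [Fintype n] (M : Matrix n n ℂ)
    (v : n → ℂ) : star v ⬝ᵥ Mᴴ *ᵥ v = star (star v ⬝ᵥ M *ᵥ v) := by
  rw [star_dotProduct, star_mulVec, conjTranspose_conjTranspose, dotProduct_mulVec]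

open scoped ComplexOrder in
theorem eq_zero_of_star_dotProduct_self_eq_zero {n : Type*} [Fintype n] {v : n → ℂ}
    (h : star v ⬝ᵥ v = 0) : v = 0 :=
  dotProduct_star_self_eq_zero.1 h

theorem finrank_le_of_isotropic {k : ℕ} (M : Matrix (Fin k) (Fin k) ℂ)
    (S : Submodule ℂ (Fin k ⊕ Fin k → ℂ))
    (hS : ∀ u ∈ S, ∀ v ∈ S, star u ⬝ᵥ fromBlocks 2 M Mᴴ (-2) *ᵥ v = 0) :
    Module.finrank ℂ S ≤ k := by
  let f : S →ₗ[ℂ] (Fin k → ℂ) := (LinearMap.funLeft ℂ ℂ Sum.inl).comp S.subtype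
  have hf : Function.Injective f := by
    rw [injective_iff_map_eq_zero]
    rintro ⟨v, hv⟩ h0
    have hx : v ∘ Sum.inl = 0 := h0
    have h1 := hS v hv v hv
    rw [fromBlocks_mulVec, hx, dotProduct, Fintype.sum_sum_type] at h1
    have hx' : ∀ i, v (Sum.inl i) = 0 := fun i => congrFun hx i
    have h2 : star (v ∘ Sum.inr) ⬝ᵥ (v ∘ Sum.inr) = 0 := by
      have h3 : (2 : Matrix (Fin k) (Fin k) ℂ) *ᵥ (v ∘ Sum.inr) = (2 : ℂ) • (v ∘ Sum.inr) := by
        rw [← Matrix.diagonal_ofNat]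
        ext i
        simp [mulVec_diagonal]
      simpa [hx', neg_mulVec, h3, dotProduct, mul_left_comm, ← Finset.mul_sum] using h1
    replace h2 := eq_zero_of_star_dotProduct_self_eq_zero h2
    ext i
    rcases i with i | i
    · exact hx' i
    · exact congrFun h2 i
  simpa using LinearMap.finrank_le_finrank_of_injective hf

theorem exists_unitary_zero_block_of_det_ne_zero {k : ℕ} (X Y : Matrix (Fin k) (Fin k) ℂ)
    (hdet : (X - Yᴴ).det ≠ 0) :
    ∃ U : Matrix (Fin k ⊕ Fin k) (Fin k ⊕ Fin k) ℂ, Uᴴ * U = 1 ∧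
      (Uᴴ * Matrix.fromBlocks 1 X Y (-1) * U).toBlocks₁₁ = 0 := by
  set M := X + Yᴴ with hM
  set N := X - Yᴴ with hN
  let J : Matrix (Fin k ⊕ Fin k) (Fin k ⊕ Fin k) ℂ := fromBlocks 1 0 0 (-1)
  let B : Matrix (Fin k ⊕ Fin k) (Fin k ⊕ Fin k) ℂ := fromBlocks 2 M Mᴴ (-2)
  let C : Matrix (Fin k ⊕ Fin k) (Fin k ⊕ Fin k) ℂ := fromBlocks 0 N (-Nᴴ) 0
  have hBC : (2 : ℂ) • fromBlocks 1 X Y (-1) = B + C := by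
    simp only [B, C, fromBlocks_add, fromBlocks_smul, hM, hN]
    congr 1
    · simp [two_smul, one_add_one_eq_two]
    · simp [two_smul]
    · simp only [two_smul, conjTranspose_add, conjTranspose_sub, conjTranspose_conjTranspose]
      abel
    · rw [two_smul, add_zero, ← neg_add, one_add_one_eq_two]
  have hB : Bᴴ = B := by simp [B, fromBlocks_conjTranspose]
  have hC : Cᴴ = -C := by simp [C, fromBlocks_conjTranspose, fromBlocks_neg]
  have hJC : (J * C)ᴴ = J * C := by
    simp [J, C, fromBlocks_multiply, fromBlocks_conjTranspose]
  have hJB : J * B + (J * B)ᴴ = (4 : ℂ) • 1 := by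
    rw [← fromBlocks_one]
    simp only [J, B, fromBlocks_multiply, fromBlocks_conjTranspose, fromBlocks_add, fromBlocks_smul]
    congr 1 <;> simp [← diagonal_ofNat, smul_one_eq_diagonal] <;> norm_num
  have hquad : ∀ v, star v ⬝ᵥ (J * B) *ᵥ v + star (star v ⬝ᵥ (J * B) *ᵥ v) = 4 * (star v ⬝ᵥ v) := by
    intro v
    rw [← star_dotProduct_conjTranspose_mulVec, ← dotProduct_add, ← add_mulVec, hJB]
    simp [smul_mulVec]
  have hBdet : IsUnit B.det := by
    rw [isUnit_iff_ne_zero]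
    intro h0
    obtain ⟨v, hv, hv0⟩ := exists_mulVec_eq_zero_iff.2 h0
    have := hquad v
    rw [← mulVec_mulVec, hv0] at this
    exact hv (eq_zero_of_star_dotProduct_self_eq_zero (by simpa using this))
  have hBT : B * (B⁻¹ * C) = C := mul_nonsing_inv_cancel_left B C hBdet
  let h : (Fin k ⊕ Fin k → ℂ) →ₗ⋆[ℂ] (Fin k ⊕ Fin k → ℂ) →ₗ[ℂ] ℂ :=
    LinearMap.mk₂'ₛₗ (starRingEnd ℂ) (RingHom.id ℂ) (fun u v => star u ⬝ᵥ B *ᵥ v)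
      (by simp [add_dotProduct]) (by simp) (by simp [mulVec_add])
      (by simp [mulVec_smul])
  have hhT : ∀ u v, h u (toLin' (B⁻¹ * C) v) = star u ⬝ᵥ C *ᵥ v := by
    intro u v
    simp only [h, LinearMap.mk₂'ₛₗ_apply, toLin'_apply]
    rw [mulVec_mulVec, hBT]
  obtain ⟨P, Q, hPQ, hP, hQ⟩ := exists_isotropic_sup_eq_top h (toLin' (B⁻¹ * C)) (by
    intro u v
    rw [hhT]
    simp only [h, LinearMap.mk₂'ₛₗ_apply, toLin'_apply]
    rw [star_mulVec, ← dotProduct_mulVec, mulVec_mulVec, ← hB, ← conjTranspose_mul, hB, hBT, hC]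
    simp [neg_mulVec]) (by
    intro a v hv ha
    have hCv : C *ᵥ v = a • B *ᵥ v := by
      rw [← mulVec_smul, ← hv, toLin'_apply, mulVec_mulVec, hBT]
    have ha' : star a = -a := by
      apply Complex.ext <;> simp [ha]
    have h1 := star_dotProduct_conjTranspose_mulVec (J * C) v
    rw [hJC, ← mulVec_mulVec, hCv, mulVec_smul, mulVec_mulVec, dotProduct_smul, smul_eq_mul,
      star_mul', ha'] at h1
    have h2 : a * (4 * (star v ⬝ᵥ v)) = 0 := by
      rw [← hquad]
      linear_combination h1
    rcases mul_eq_zero.1 h2 with rfl | h2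
    · rw [zero_smul, fromBlocks_mulVec] at hCv
      have hy : N *ᵥ (v ∘ Sum.inr) = 0 := by
        ext i; simpa using congrFun hCv (Sum.inl i)
      have hx : Nᴴ *ᵥ (v ∘ Sum.inl) = 0 := by
        ext i; simpa [neg_mulVec] using congrFun hCv (Sum.inr i)
      have hy' := eq_zero_of_mulVec_eq_zero hdet hy
      have hx' := eq_zero_of_mulVec_eq_zero (by simpa [det_conjTranspose] using hdet) hx
      ext i
      rcases i with i | i
      · exact congrFun hx' i
      · exact congrFun hy' i
    · exact eq_zero_of_star_dotProduct_self_eq_zero (by simpa using h2))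
  have hPk : Module.finrank ℂ P ≤ k := finrank_le_of_isotropic M P fun u hu v hv => (hP u hu v hv).1
  have hQk : Module.finrank ℂ Q ≤ k := finrank_le_of_isotropic M Q hQ
  have hsum := Submodule.finrank_add_le_finrank_add_finrank P Q
  rw [hPQ, finrank_top, Module.finrank_fintype_fun_eq_card, Fintype.card_sum, Fintype.card_fin]
    at hsum
  refine exists_unitary_zero_block_of_submodule _ P (by omega) fun u hu v hv => ?_
  have h1 : star u ⬝ᵥ B *ᵥ v = 0 := (hP u hu v hv).1
  have h2 := (hP u hu v hv).2
  rw [hhT] at h2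
  have h3 : (2 : ℂ) * (star u ⬝ᵥ fromBlocks 1 X Y (-1) *ᵥ v) = 0 := by
    rw [← smul_eq_mul, ← dotProduct_smul, ← smul_mulVec, hBC, add_mulVec, dotProduct_add, h1, h2,
      add_zero]
  simpa using h3

theorem isCompact_setOf_conjTranspose_mul_self_eq_one (n : Type*) [Fintype n] [DecidableEq n] :
    IsCompact {U : Matrix n n ℂ | Uᴴ * U = 1} := by
  have h : IsCompact (Set.univ.pi fun _ : n => Set.univ.pi fun _ : n =>
      Metric.closedBall (0 : ℂ) 1) :=
    isCompact_univ_pi fun _ => isCompact_univ_pi fun _ => isCompact_closedBall _ _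
  refine IsCompact.of_isClosed_subset (X := n → n → ℂ) h ?_ ?_
  · exact isClosed_eq (X := Matrix n n ℂ) (by fun_prop) continuous_const
  · intro U hU i _ j _
    rw [mem_closedBall_zero_iff]
    exact entry_norm_bound_of_unitary (mem_unitaryGroup_iff'.2 hU) i j

/-- For `A = [[I, X], [Y, -I]]` there is a unitary `U` such that `U*AU` has zero
leading principal `k × k` submatrix (the `(1,1)` block). -/
theorem exists_unitary_zero_block {k : ℕ} (X Y : Matrix (Fin k) (Fin k) ℂ) :
    ∃ U : Matrix (Fin k ⊕ Fin k) (Fin k ⊕ Fin k) ℂ, Uᴴ * U = 1 ∧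
      (Uᴴ * Matrix.fromBlocks 1 X Y (-1) * U).toBlocks₁₁ = 0 := by
  have := isCompact_iff_compactSpace.1
    (isCompact_setOf_conjTranspose_mul_self_eq_one (Fin k ⊕ Fin k))
  let Z : Set ({U : Matrix (Fin k ⊕ Fin k) (Fin k ⊕ Fin k) ℂ | Uᴴ * U = 1} × ℂ) :=
    {p | ((p.1 : Matrix (Fin k ⊕ Fin k) (Fin k ⊕ Fin k) ℂ)ᴴ *
      Matrix.fromBlocks 1 (X + p.2 • 1) Y (-1) * p.1.1).toBlocks₁₁ = 0}
  have hZ : IsClosed Z := by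
    refine isClosed_eq ?_ continuous_const
    unfold toBlocks₁₁
    fun_prop
  have hcl : IsClosed (Prod.snd '' Z) := isClosedMap_snd_of_compactSpace _ hZ
  have hfin : {t : ℂ | (Yᴴ - X).charpoly.IsRoot t}.Finite :=
    Polynomial.finite_setOfPred_isRoot (charpoly_monic _).ne_zero
  have hsub : {t : ℂ | (Yᴴ - X).charpoly.IsRoot t}ᶜ ⊆ Prod.snd '' Z := by
    intro t ht
    obtain ⟨U, hU, hU'⟩ := exists_unitary_zero_block_of_det_ne_zero (X + t • 1) Y (by
      intro h0
      apply ht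
      rw [Set.mem_ofPred_eq, Polynomial.IsRoot, eval_charpoly, ← h0, scalar_apply, ← smul_one_eq_diagonal]
      congr 1
      abel)
    exact ⟨(⟨U, hU⟩, t), hU', rfl⟩
  have h0 : (0 : ℂ) ∈ Prod.snd '' Z := by
    rw [← hcl.closure_eq, ((hfin.countable.dense_compl ℂ).mono hsub).closure_eq]
    trivial
  obtain ⟨⟨⟨U, hU⟩, t⟩, hUt, rfl⟩ := h0
  exact ⟨U, hU, by simpa [Z] using hUt⟩
end

section
/- Let R, S be k×k complex matrices. Then there exists a k×k complex matrix Z such that I_k + RZ + Z*S* − Z*Z = 0. -/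
open Matrix

open scoped ComplexOrder MatrixOrder Matrix.Norms.L2Operator

/-- If `X` is Hermitian and `H` is positive definite, then `X - m • H` is positive semidefinite
and singular for some real `m` (the least generalized eigenvalue). -/
theorem Matrix.IsHermitian.exists_posSemidef_sub_smul {n : Type*} [Fintype n] [Nonempty n]
    {X H : Matrix n n ℂ} (hX : X.IsHermitian) (hH : H.PosDef) :
    ∃ m : ℝ, ∃ v : n → ℂ, v ≠ 0 ∧ (X - (m : ℂ) • H).PosSemidef ∧ (X - (m : ℂ) • H) *ᵥ v = 0 := by
  classical
  have hpos : ∀ v : n → ℂ, v ≠ 0 → 0 < (star v ⬝ᵥ (H *ᵥ v)).re := fun v hv =>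
    (Complex.pos_iff.1 (hH.dotProduct_mulVec_pos hv)).1
  have hne : ∀ v ∈ Metric.sphere (0 : n → ℂ) 1, v ≠ 0 := fun v hv =>
    ne_zero_of_mem_unit_sphere ⟨v, hv⟩
  obtain ⟨v, hv, hmin⟩ := (isCompact_sphere (0 : n → ℂ) 1).exists_isMinOn
    (NormedSpace.sphere_nonempty.2 zero_le_one)
    (f := fun v => (star v ⬝ᵥ (X *ᵥ v)).re / (star v ⬝ᵥ (H *ᵥ v)).re)
    (ContinuousOn.div (by fun_prop) (by fun_prop) fun v hv => (hpos v (hne v hv)).ne')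
  set m : ℝ := (star v ⬝ᵥ (X *ᵥ v)).re / (star v ⬝ᵥ (H *ᵥ v)).re with hm
  have hherm : (X - (m : ℂ) • H).IsHermitian := by
    refine hX.sub ?_
    rw [IsHermitian, conjTranspose_smul, hH.isHermitian.eq]
    simp
  have him : ∀ w : n → ℂ, (star w ⬝ᵥ ((X - (m : ℂ) • H) *ᵥ w)).im = 0 := fun w =>
    hherm.im_star_dotProduct_mulVec_self w
  have hre : ∀ w : n → ℂ, (star w ⬝ᵥ ((X - (m : ℂ) • H) *ᵥ w)).re =
      (star w ⬝ᵥ (X *ᵥ w)).re - m * (star w ⬝ᵥ (H *ᵥ w)).re := fun w => by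
    simp [sub_mulVec, smul_mulVec, dotProduct_sub]
  have hpsd : (X - (m : ℂ) • H).PosSemidef := by
    refine .of_dotProduct_mulVec_nonneg hherm fun w => ?_
    rw [Complex.nonneg_iff]
    refine ⟨?_, (him w).symm⟩
    rcases eq_or_ne w 0 with rfl | hw
    · simp
    have hnw : ‖w‖ ≠ 0 := norm_ne_zero_iff.2 hw
    set u : n → ℂ := ((‖w‖⁻¹ : ℝ) : ℂ) • w with hu
    have hus : u ∈ Metric.sphere (0 : n → ℂ) 1 := by
      simp [hu, norm_smul, hnw]
    have h1 : m ≤ (star u ⬝ᵥ (X *ᵥ u)).re / (star u ⬝ᵥ (H *ᵥ u)).re := hmin hus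
    rw [le_div_iff₀ (hpos u (hne u hus)), ← sub_nonneg, ← hre] at h1
    obtain ⟨t, ht⟩ : ∃ t : ℝ, w = (t : ℂ) • u := by
      refine ⟨‖w‖, ?_⟩
      rw [hu, smul_smul, ← Complex.ofReal_mul, mul_inv_cancel₀ hnw]
      simp
    have h3 : star w ⬝ᵥ ((X - (m : ℂ) • H) *ᵥ w) =
        ((t * t : ℝ) : ℂ) * (star u ⬝ᵥ ((X - (m : ℂ) • H) *ᵥ u)) := by
      generalize X - (m : ℂ) • H = Y
      rw [ht]
      simp [mulVec_smul, mul_assoc]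
    rw [h3, Complex.re_ofReal_mul]
    exact mul_nonneg (mul_self_nonneg t) h1
  refine ⟨m, v, hne v hv, hpsd, ?_⟩
  rw [← hpsd.dotProduct_mulVec_zero_iff]
  refine Complex.ext ?_ (him v)
  rw [hre, hm, div_mul_cancel₀ _ (hpos v (hne v hv)).ne']
  simp

section Lyapunov

variable {n : Type*} [Fintype n] {N H X : Matrix n n ℂ}

/-- If the Lyapunov inequality `N H + H Nᴴ < 0` has a positive definite solution `H`, then
`N X + X Nᴴ ≤ 0` implies `0 ≤ X`. -/
theorem Matrix.PosDef.posSemidef_of_lyapunov (hH : H.PosDef)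
    (hN : (-(N * H + H * Nᴴ)).PosDef) (hX : X.IsHermitian)
    (hNX : (-(N * X + X * Nᴴ)).PosSemidef) : X.PosSemidef := by
  cases isEmpty_or_nonempty n
  · rw [Subsingleton.elim X 0]; exact .zero
  obtain ⟨m, v, hv, hpsd, hker⟩ := hX.exists_posSemidef_sub_smul hH
  have hm : 0 ≤ m := by
    by_contra! hm
    have h1 := (Complex.pos_iff.1 (hN.dotProduct_mulVec_pos hv)).1
    have h2 := (Complex.nonneg_iff.1 (hNX.dotProduct_mulVec_nonneg v)).1
    set Y := X - (m : ℂ) • H with hY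
    have h3 : -(N * X + X * Nᴴ) = -(N * Y + Y * Nᴴ) + (m : ℂ) • -(N * H + H * Nᴴ) := by
      simp only [hY, mul_sub, sub_mul, Matrix.mul_smul, Matrix.smul_mul, smul_neg, smul_add]
      abel
    have h4 : star v ⬝ᵥ ((N * Y + Y * Nᴴ) *ᵥ v) = 0 := by
      have h5 : star v ᵥ* Y = 0 := by
        rw [← hpsd.isHermitian.eq, ← star_mulVec, hker, star_zero]
      rw [add_mulVec, ← mulVec_mulVec, hker, ← mulVec_mulVec, dotProduct_add,
        dotProduct_mulVec _ Y, h5]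
      simp
    rw [h3, add_mulVec, dotProduct_add, neg_mulVec, dotProduct_neg, h4, smul_mulVec,
      dotProduct_smul, smul_eq_mul, neg_zero, zero_add, Complex.re_ofReal_mul] at h2
    nlinarith
  rw [← sub_add_cancel X ((m : ℂ) • H)]
  exact hpsd.add (hH.posSemidef.smul (by exact_mod_cast hm))

/-- If the Lyapunov inequality `N H + H Nᴴ < 0` has a positive definite solution, then the
Lyapunov equation `N X + X Nᴴ = G` has a Hermitian solution for every Hermitian `G`. -/
theorem Matrix.PosDef.exists_isHermitian_lyapunov_eq (hH : H.PosDef)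
    (hN : (-(N * H + H * Nᴴ)).PosDef) {G : Matrix n n ℂ} (hG : G.IsHermitian) :
    ∃ X : Matrix n n ℂ, X.IsHermitian ∧ N * X + X * Nᴴ = G := by
  have herm : ∀ X : Matrix n n ℂ, X.IsHermitian → N * X + X * Nᴴ = 0 → X = 0 := by
    intro X hX h
    refine le_antisymm ?_ ?_
    · rw [← neg_nonneg]
      refine (hH.posSemidef_of_lyapunov hN hX.neg ?_).nonneg
      rw [mul_neg, neg_mul, ← neg_add, h, neg_zero, neg_zero]
      exact .zero
    · refine (hH.posSemidef_of_lyapunov hN hX ?_).nonneg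
      rw [h, neg_zero]
      exact .zero
  have hstar : ∀ X : Matrix n n ℂ, N * Xᴴ + Xᴴ * Nᴴ = (N * X + X * Nᴴ)ᴴ := by
    intro X
    simp only [conjTranspose_add, conjTranspose_mul, conjTranspose_conjTranspose]
    abel
  let L : Matrix n n ℂ →ₗ[ℂ] Matrix n n ℂ :=
    { toFun := fun X => N * X + X * Nᴴ
      map_add' := fun X Y => by simp only [mul_add, add_mul]; abel
      map_smul' := fun c X => by simp }
  have hinj : Function.Injective L := by
    rw [injective_iff_map_eq_zero]
    intro X hX
    replace hX : N * X + X * Nᴴ = 0 := hX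
    have hX' : N * Xᴴ + Xᴴ * Nᴴ = 0 := by rw [hstar, hX, conjTranspose_zero]
    have h1 : X + Xᴴ = 0 := by
      refine herm _ (isHermitian_add_transpose_self X) ?_
      rw [mul_add, add_mul, add_add_add_comm, hX, hX', add_zero]
    have h2 : Complex.I • (X - Xᴴ) = 0 := by
      refine herm _ ?_ ?_
      · simp [IsHermitian, conjTranspose_smul, ← smul_neg]
      · rw [Matrix.mul_smul, Matrix.smul_mul, ← smul_add, mul_sub, sub_mul, sub_add_sub_comm,
          hX, hX', sub_zero, smul_zero]
    have h3 : X - Xᴴ = 0 := (smul_eq_zero.1 h2).resolve_left Complex.I_ne_zero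
    have h4 : (2 : ℂ) • X = 0 := by
      rw [two_smul, ← add_zero (0 : Matrix n n ℂ)]
      nth_rewrite 1 [← h1]
      rw [← h3]
      abel
    exact (smul_eq_zero.1 h4).resolve_left two_ne_zero
  obtain ⟨X, hX⟩ := LinearMap.surjective_of_injective hinj G
  replace hX : N * X + X * Nᴴ = G := hX
  have hX' : N * Xᴴ + Xᴴ * Nᴴ = G := by rw [hstar, hX, hG.eq]
  refine ⟨(2⁻¹ : ℂ) • (X + Xᴴ), ?_, ?_⟩
  · rw [IsHermitian, conjTranspose_smul, (isHermitian_add_transpose_self X).eq]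
    simp
  · rw [Matrix.mul_smul, Matrix.smul_mul, ← smul_add, mul_add, add_mul, add_add_add_comm, hX, hX',
      ← two_smul ℂ G, smul_smul]
    simp

end Lyapunov

section Riccati

variable {n : Type*} [Fintype n] [DecidableEq n] {F M : Matrix n n ℂ}

/-- The Riccati inequality `1 + F H + H Fᴴ ≤ H M H` has a positive semidefinite solution. -/
theorem Matrix.PosDef.exists_riccati_le (F : Matrix n n ℂ) (hM : M.PosDef) :
    ∃ H : Matrix n n ℂ, 0 ≤ H ∧ 1 + F * H + H * Fᴴ ≤ H * M * H := by
  have key : ∀ X : Matrix n n ℂ, X.IsHermitian → ∃ a : ℝ, 0 ≤ a ∧ X ≤ (a : ℂ) • M := by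
    intro X hX
    cases isEmpty_or_nonempty n
    · exact ⟨0, le_rfl, (Subsingleton.elim _ _).le⟩
    obtain ⟨m, -, -, h, -⟩ := hX.neg.exists_posSemidef_sub_smul hM
    refine ⟨max 0 (-m), le_max_left _ _, ?_⟩
    have h1 : ((max 0 (-m) + m : ℝ) : ℂ) • M ≥ 0 := by
      refine (hM.posSemidef.smul ?_).nonneg
      have := le_max_right 0 (-m)
      exact_mod_cast (by linarith : 0 ≤ max 0 (-m) + m)
    have h2 := add_nonneg h.nonneg h1
    rw [← sub_nonneg]
    convert h2 using 1
    push_cast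
    module
  obtain ⟨a, ha, hFa⟩ := key (F + Fᴴ) (isHermitian_add_transpose_self F)
  obtain ⟨b, hb, h1b⟩ := key 1 isHermitian_one
  set c : ℝ := a + b + 1 with hc
  have hc0 : 0 ≤ c := by positivity
  refine ⟨(c : ℂ) • 1, (PosSemidef.one.smul (by exact_mod_cast hc0)).nonneg, ?_⟩
  have h1 : 0 ≤ (c : ℂ) • ((a : ℂ) • M - (F + Fᴴ)) :=
    (PosSemidef.smul (sub_nonneg.2 hFa).posSemidef (by exact_mod_cast hc0)).nonneg
  have h2 : 0 ≤ ((c * c - c * a - b : ℝ) : ℂ) • M := by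
    refine (hM.posSemidef.smul ?_).nonneg
    have : 0 ≤ c * c - c * a - b := by rw [hc]; nlinarith [mul_nonneg ha hb]
    exact_mod_cast this
  have h3 := add_nonneg (add_nonneg h1 (sub_nonneg.2 h1b)) h2
  rw [← sub_nonneg]
  convert h3 using 1
  simp only [Matrix.mul_smul, Matrix.smul_mul, mul_one, one_mul]
  push_cast
  module

/-- The algebraic Riccati equation `1 + F H + H Fᴴ = H M H` with `M` positive definite has a
positive semidefinite solution. -/
theorem Matrix.PosDef.exists_riccati_eq (F : Matrix n n ℂ) (hM : M.PosDef) :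
    ∃ H : Matrix n n ℂ, H.PosSemidef ∧ 1 + F * H + H * Fᴴ = H * M * H := by
  obtain ⟨H₀, hH₀, hR₀⟩ := hM.exists_riccati_le F
  let K : Set (Matrix n n ℂ) := {H | 0 ≤ H ∧ H ≤ H₀ ∧ 1 + F * H + H * Fᴴ ≤ H * M * H}
  have hKc : IsCompact K := by
    refine (isCompact_closedBall (0 : Matrix n n ℂ) ‖H₀‖).of_isClosed_subset ?_ ?_
    · exact isClosed_Ici.inter (isClosed_Iic.inter
        (isClosed_le (f := fun H => 1 + F * H + H * Fᴴ) (g := fun H => H * M * H)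
          (by fun_prop) (by fun_prop)))
    · intro H hH
      rw [mem_closedBall_zero_iff]
      exact CStarAlgebra.norm_le_norm_of_nonneg_of_le hH.1 hH.2.1
  obtain ⟨H, ⟨hH0, hHle, hR⟩, hmin⟩ := hKc.exists_isMinOn ⟨H₀, hH₀, le_rfl, hR₀⟩
    (f := fun H => H.trace.re) (by fun_prop)
  have hHs : Hᴴ = H := hH0.posSemidef.isHermitian.eq
  have hMs : Mᴴ = M := hM.isHermitian.eq
  refine ⟨H, hH0.posSemidef, ?_⟩
  set N := F - H * M with hN
  have hNs : Nᴴ = Fᴴ - M * H := by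
    rw [hN, conjTranspose_sub, conjTranspose_mul, hHs, hMs]
  set G := H * M * H - (1 + F * H + H * Fᴴ) with hG
  have hGp : G.PosSemidef := hR
  have hHMH : ∀ Y : Matrix n n ℂ, Yᴴ = Y → (Y * M * Y).PosSemidef := fun Y hY => by
    have := hM.posSemidef.mul_mul_conjTranspose_same Y
    rwa [hY] at this
  have hlyap : -(N * H + H * Nᴴ) = 1 + (H * M * H + G) := by
    rw [hNs, hN, hG]
    noncomm_ring
  have hNneg : (-(N * H + H * Nᴴ)).PosDef := by
    rw [hlyap]
    exact PosDef.one.add_posSemidef ((hHMH H hHs).add hGp)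
  have hHpd : H.PosDef := by
    refine .of_dotProduct_mulVec_pos hHs fun x hx => ?_
    refine (hH0.posSemidef.dotProduct_mulVec_nonneg x).lt_of_ne' fun h0 => ?_
    have h1 : H *ᵥ x = 0 := (hH0.posSemidef.dotProduct_mulVec_zero_iff x).1 h0
    have h2 : star x ᵥ* H = 0 := by rw [← hHs, ← star_mulVec, h1, star_zero]
    have h3 := hNneg.dotProduct_mulVec_pos hx
    rw [neg_mulVec, add_mulVec, ← mulVec_mulVec, h1, ← mulVec_mulVec, dotProduct_neg,
      dotProduct_add, dotProduct_mulVec _ H, h2] at h3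
    simp at h3
  obtain ⟨D, hD, hDeq⟩ := hHpd.exists_isHermitian_lyapunov_eq hNneg hGp.isHermitian
  have hDneg : (-D).PosSemidef := by
    refine hHpd.posSemidef_of_lyapunov hNneg hD.neg ?_
    rw [mul_neg, neg_mul, ← neg_add, neg_neg, hDeq]
    exact hGp
  have hHD : (H + D).PosSemidef := by
    refine hHpd.posSemidef_of_lyapunov hNneg (hH0.posSemidef.isHermitian.add hD) ?_
    have : -(N * (H + D) + (H + D) * Nᴴ) = 1 + H * M * H := by
      calc -(N * (H + D) + (H + D) * Nᴴ) = -(N * H + H * Nᴴ) - (N * D + D * Nᴴ) := by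
            noncomm_ring
        _ = 1 + H * M * H := by rw [hlyap, hDeq]; abel
    rw [this]
    exact PosSemidef.one.add (hHMH H hHs)
  have hric : (H + D) * M * (H + D) - (1 + F * (H + D) + (H + D) * Fᴴ) = D * M * D := by
    calc (H + D) * M * (H + D) - (1 + F * (H + D) + (H + D) * Fᴴ)
        = G - (N * D + D * Nᴴ) + D * M * D := by
          rw [hNs, hN, hG]
          noncomm_ring
      _ = D * M * D := by rw [hDeq, sub_self, zero_add]
  have hmem : H + D ∈ K := by
    refine ⟨hHD.nonneg, le_trans ?_ hHle, ?_⟩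
    · have := hDneg.nonneg
      rw [neg_nonneg] at this
      exact add_le_of_nonpos_right this
    · rw [← sub_nonneg, hric]
      exact (hHMH D hD.eq).nonneg
  have htr : H.trace.re ≤ (H + D).trace.re := hmin hmem
  have hD0 : D = 0 := by
    rw [← neg_eq_zero, ← hDneg.trace_eq_zero_iff]
    have h1 := Complex.nonneg_iff.1 hDneg.trace_nonneg
    refine Complex.ext (le_antisymm ?_ h1.1) h1.2.symm
    rw [trace_add, Complex.add_re] at htr
    rw [trace_neg, Complex.neg_re, Complex.zero_re]
    linarith
  rw [hD0, mul_zero, zero_mul, add_zero] at hDeq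
  exact (sub_eq_zero.1 hDeq.symm).symm

end Riccati

section

variable {n : Type*} [Fintype n] [DecidableEq n]

theorem exists_isHermitian_mul_and_eq_of_isUnit (A : Matrix n n ℂ) {B : Matrix n n ℂ}
    (hB : IsUnit B) :
    ∃ Z : Matrix n n ℂ, (B * Z).IsHermitian ∧ Zᴴ * Z = 1 + A * Z + (A * Z)ᴴ := by
  have hC : IsUnit B⁻¹ := (isUnit_nonsing_inv_iff).2 hB
  have hM : (B⁻¹ᴴ * B⁻¹).PosDef :=
    PosDef.conjTranspose_mul_self _ (mulVec_injective_of_isUnit hC)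
  obtain ⟨H, hH, hR⟩ := hM.exists_riccati_eq (A * B⁻¹)
  refine ⟨B⁻¹ * H, ?_, ?_⟩
  · rw [mul_nonsing_inv_cancel_left _ _ ((isUnit_iff_isUnit_det B).1 hB)]
    exact hH.isHermitian
  · simp only [conjTranspose_mul, hH.isHermitian.eq, mul_assoc] at hR ⊢
    exact hR.symm

theorem norm_le_of_conjTranspose_mul_self_eq {A Z : Matrix n n ℂ}
    (h : Zᴴ * Z = 1 + A * Z + (A * Z)ᴴ) : ‖Z‖ ≤ 2 * ‖A‖ + ‖(1 : Matrix n n ℂ)‖ + 1 := by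
  have h1 : ‖Z‖ * ‖Z‖ ≤ ‖(1 : Matrix n n ℂ)‖ + ‖A‖ * ‖Z‖ + ‖A‖ * ‖Z‖ := by
    rw [← l2_opNorm_conjTranspose_mul_self, h]
    refine (norm_add₃_le).trans ?_
    rw [l2_opNorm_conjTranspose]
    gcongr <;> exact norm_mul_le _ _
  by_contra! h2
  nlinarith [norm_nonneg A, norm_nonneg (1 : Matrix n n ℂ), norm_nonneg Z]

theorem exists_pos_lt_isUnit_add_smul_one (B : Matrix n n ℂ) {δ : ℝ} (hδ : 0 < δ) :
    ∃ ε : ℝ, 0 < ε ∧ ε < δ ∧ IsUnit (B + (ε : ℂ) • 1) := by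
  have hfin : {ε : ℝ | (ε : ℂ) ∈ spectrum ℂ (-B)}.Finite :=
    (Matrix.finite_spectrum (-B)).preimage Complex.ofReal_injective.injOn
  obtain ⟨ε, hε, hns⟩ := (Set.Ioo_infinite hδ).exists_notMem_finite hfin
  refine ⟨ε, hε.1, hε.2, ?_⟩
  have := spectrum.notMem_iff.1 hns
  rwa [Algebra.algebraMap_eq_smul_one, sub_neg_eq_add, add_comm] at this

end

/-- For any `R, S ∈ M_k(ℂ)` the equation `I + RZ + Z*S* - Z*Z = 0` is solvable. -/
theorem exists_solution_matrix_eq {k : ℕ} (R S : Matrix (Fin k) (Fin k) ℂ) :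
    ∃ Z : Matrix (Fin k) (Fin k) ℂ, 1 + R * Z + Zᴴ * Sᴴ - Zᴴ * Z = 0 := by
  set A := (2⁻¹ : ℂ) • (R + S) with hA
  set B := (2⁻¹ : ℂ) • (R - S) with hB
  have hR : R = A + B := by rw [hA, hB]; module
  have hS : S = A - B := by rw [hA, hB]; module
  set r := 2 * ‖A‖ + ‖(1 : Matrix (Fin k) (Fin k) ℂ)‖ + 1
  have hr : 0 < r := by positivity
  let g : Matrix (Fin k) (Fin k) ℂ → Matrix (Fin k) (Fin k) ℂ :=
    fun Z => 1 + R * Z + Zᴴ * Sᴴ - Zᴴ * Z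
  have hcl : IsClosed (g '' Metric.closedBall 0 r) :=
    ((isCompact_closedBall 0 r).image (by fun_prop)).isClosed
  have hmem : (0 : Matrix (Fin k) (Fin k) ℂ) ∈ g '' Metric.closedBall 0 r := by
    rw [← hcl.closure_eq, Metric.mem_closure_iff]
    intro e he
    obtain ⟨ε, hε0, hε, hu⟩ := exists_pos_lt_isUnit_add_smul_one B (δ := e / (2 * r))
      (by positivity)
    obtain ⟨Z, hZ, hZeq⟩ := exists_isHermitian_mul_and_eq_of_isUnit A hu
    have hZr : ‖Z‖ ≤ r := norm_le_of_conjTranspose_mul_self_eq hZeq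
    refine ⟨g Z, ⟨Z, mem_closedBall_zero_iff.2 hZr, rfl⟩, ?_⟩
    have hgZ : g Z = (ε : ℂ) • (Zᴴ - Z) := by
      have h1 : Zᴴ * Bᴴ + (ε : ℂ) • Zᴴ = B * Z + (ε : ℂ) • Z := by
        simpa [IsHermitian, conjTranspose_smul, mul_add, add_mul] using hZ
      have h2 : g Z = B * Z - Zᴴ * Bᴴ := by
        simp only [g]
        rw [hZeq, hR, hS, conjTranspose_sub, conjTranspose_mul]
        noncomm_ring
      rw [h2, smul_sub, sub_eq_sub_iff_add_eq_add, ← h1, add_comm]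
    rw [dist_zero_left, hgZ, norm_smul, Complex.norm_of_nonneg hε0.le]
    calc ε * ‖Zᴴ - Z‖ ≤ ε * (2 * r) := by
          gcongr
          refine (norm_sub_le _ _).trans ?_
          rw [l2_opNorm_conjTranspose]
          linarith
      _ < e := (lt_div_iff₀ (by positivity)).1 hε
  obtain ⟨Z, -, hZ⟩ := hmem
  exact ⟨Z, hZ⟩
end

section
/- Let R, S be k×k complex matrices. Then there exists a k×k complex matrix Z satisfying simultaneously I_k + RZ + Z*R* − Z*Z = 0 and SZ + Z*S* = 0. -/
open Matrix

namespace CommonSolutionPair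

open scoped Matrix.Norms.L2Operator MatrixOrder ComplexOrder

variable {n : Type*} [Fintype n] [DecidableEq n]

theorem differentiable_det : Differentiable ℂ (fun A : Matrix n n ℂ => A.det) := by
  have h (i j : n) : Differentiable ℂ (fun A : Matrix n n ℂ => A i j) :=
    (LinearMap.toContinuousLinearMap (Matrix.entryLinearMap ℂ ℂ i j)).differentiable
  simp only [Matrix.det_apply]
  fun_prop

/-- The derivative of the determinant at the identity is the trace. -/
theorem fderiv_det_one (A : Matrix n n ℂ) :
    fderiv ℂ (fun A : Matrix n n ℂ => A.det) 1 A = A.trace := by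
  have h1 : HasDerivAt (fun s : ℂ => (1 : Matrix n n ℂ) + s • A) A 0 := by
    simpa using ((hasDerivAt_id (0 : ℂ)).smul_const A).const_add (1 : Matrix n n ℂ)
  have h2 : HasFDerivAt (fun A : Matrix n n ℂ => A.det)
      (fderiv ℂ (fun A : Matrix n n ℂ => A.det) 1) (1 + (0 : ℂ) • A) := by
    simpa using (differentiable_det (1 : Matrix n n ℂ)).hasFDerivAt
  have h3 := h2.comp_hasDerivAt (0 : ℂ) h1
  have h4 := (Matrix.det (1 + (Polynomial.X : Polynomial ℂ) • A.map Polynomial.C)).hasDerivAt 0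
  rw [Matrix.derivative_det_one_add_X_smul] at h4
  refine h3.unique (h4.congr_of_eventuallyEq (Filter.Eventually.of_forall fun s => ?_))
  simp [_root_.eval_det, ← smul_eq_mul_diagonal]

/-- Jacobi's formula along a curve of matrices. -/
theorem hasDerivAt_det {F : ℝ → Matrix n n ℂ} {F' : Matrix n n ℂ} {t : ℝ}
    (hF : HasDerivAt F F' t) (ht : IsUnit (F t).det) :
    HasDerivAt (fun s => (F s).det) ((F t).det * ((F t)⁻¹ * F').trace) t := by
  have h1 : HasDerivAt (fun s => (F t)⁻¹ * F s) ((F t)⁻¹ * F') t := hF.const_mul _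
  have h2 : HasFDerivAt (fun A : Matrix n n ℂ => A.det)
      (fderiv ℂ (fun A : Matrix n n ℂ => A.det) 1) ((F t)⁻¹ * F t) := by
    rw [Matrix.nonsing_inv_mul _ ht]
    exact (differentiable_det (1 : Matrix n n ℂ)).hasFDerivAt
  have h3 := ((h2.restrictScalars ℝ).comp_hasDerivAt t h1).const_mul (F t).det
  convert! h3 using 1
  · ext s
    simp [Matrix.det_mul, Matrix.det_nonsing_inv, ht.ne_zero]
  · simp [fderiv_det_one]


/-- A continuous curve of Hermitian matrices stays positive semidefinite near a point where it is
positive definite. -/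
theorem eventually_nonneg {F : ℝ → Matrix n n ℂ} {t : ℝ} (hF : ContinuousAt F t)
    (hs : ∀ s, (F s).IsHermitian) (ht : (F t).PosDef) : ∀ᶠ s in nhds t, 0 ≤ F s := by
  cases isEmpty_or_nonempty n
  · exact Filter.Eventually.of_forall fun s => (Subsingleton.elim 0 (F s)).le
  obtain ⟨r, hr, h⟩ := (CFC.exists_pos_algebraMap_le_iff (A := Matrix n n ℂ) (a := F t)
    ht.1).2 (fun x hx => ht.isStrictlyPositive.spectrum_pos hx)
  filter_upwards [hF (Metric.ball_mem_nhds _ hr)] with s hsr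
  have h1 : IsSelfAdjoint (F s - F t) := (hs s).sub (hs t)
  have h3 : algebraMap ℝ (Matrix n n ℂ) ‖F s - F t‖ ≤ algebraMap ℝ (Matrix n n ℂ) r :=
    algebraMap_mono _ (mem_ball_iff_norm.1 hsr).le
  have h4 := add_le_add ((neg_le_neg h3).trans h1.neg_algebraMap_norm_le_self) h
  simpa using h4

/-- The defect of the quadratic equation at `Z`. -/
def defect (R Z : Matrix n n ℂ) : Matrix n n ℂ := 1 + R * Z + Zᴴ * Rᴴ - Zᴴ * Z

theorem isHermitian_defect (R Z : Matrix n n ℂ) : (defect R Z).IsHermitian := by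
  simp only [defect, IsHermitian, conjTranspose_sub, conjTranspose_add, conjTranspose_mul,
    conjTranspose_one, conjTranspose_conjTranspose]
  abel

theorem continuous_defect (R : Matrix n n ℂ) : Continuous (defect R) := by
  unfold defect
  fun_prop

theorem norm_sub_sq_le (R Z : Matrix n n ℂ) (h : 0 ≤ defect R Z) :
    ‖Z - Rᴴ‖ * ‖Z - Rᴴ‖ ≤ ‖1 + R * Rᴴ‖ := by
  rw [← CStarRing.norm_star_mul_self]
  refine CStarAlgebra.norm_le_norm_of_nonneg_of_le (star_mul_self_nonneg _) ?_
  rw [← sub_nonneg]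
  convert! h using 1
  simp only [defect, star_eq_conjTranspose, conjTranspose_sub, conjTranspose_conjTranspose]
  noncomm_ring

theorem isBounded_defect_nonneg (R : Matrix n n ℂ) :
    Bornology.IsBounded {Z : Matrix n n ℂ | 0 ≤ defect R Z} := by
  refine (Metric.isBounded_closedBall (x := Rᴴ) (r := ‖1 + R * Rᴴ‖ + 1)).subset fun Z hZ => ?_
  have := norm_sub_sq_le R Z hZ
  rw [mem_closedBall_iff_norm]
  nlinarith [norm_nonneg (Z - Rᴴ), norm_nonneg (1 + R * Rᴴ)]

theorem isCompact_feasible (R S : Matrix n n ℂ) :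
    IsCompact {Z : Matrix n n ℂ | 0 ≤ defect R Z ∧ S * Z + Zᴴ * Sᴴ = 0} := by
  refine Metric.isCompact_of_isClosed_isBounded ?_
    ((isBounded_defect_nonneg R).subset fun Z hZ => hZ.1)
  exact (isClosed_Ici.preimage (continuous_defect R)).inter
    (isClosed_eq (by fun_prop) continuous_const)

theorem hasDerivAt_defect (R Z V : Matrix n n ℂ) :
    HasDerivAt (fun s : ℝ => defect R (Z + s • V))
      ((R - Zᴴ) * V + Vᴴ * (R - Zᴴ)ᴴ) 0 := by
  have h (s : ℝ) : defect R (Z + s • V) =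
      defect R Z + s • ((R - Zᴴ) * V + Vᴴ * (R - Zᴴ)ᴴ) - s ^ 2 • (Vᴴ * V) := by
    simp only [defect, conjTranspose_add, conjTranspose_smul, star_trivial, conjTranspose_sub,
      conjTranspose_conjTranspose, mul_add, add_mul, sub_mul, mul_sub, smul_mul_assoc,
      mul_smul_comm, smul_add, smul_sub, smul_smul, pow_two]
    abel
  simp only [h]
  have h1 := ((hasDerivAt_id (0 : ℝ)).smul_const
    ((R - Zᴴ) * V + Vᴴ * (R - Zᴴ)ᴴ)).const_add (defect R Z)
  have h2 := ((hasDerivAt_id (0 : ℝ)).pow 2).smul_const (Vᴴ * V)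
  convert! h1.sub h2 using 1
  simp

/-- The exponential of the logarithmic barrier `log det (defect R Z) + t tr (-i S Z)`. -/
noncomputable def barrier (R S : Matrix n n ℂ) (t : ℝ) (Z : Matrix n n ℂ) : ℝ :=
  (defect R Z).det.re * Real.exp (t * (-Complex.I • (S * Z)).trace.re)

/-- First-order condition for a maximiser of the barrier functional. -/
theorem stationary_of_isMaxOn_barrier {R S Z V : Matrix n n ℂ} {t : ℝ}
    (hZ : IsMaxOn (barrier R S t) {Z | 0 ≤ defect R Z ∧ S * Z + Zᴴ * Sᴴ = 0} Z)
    (hZS : S * Z + Zᴴ * Sᴴ = 0) (hpos : (defect R Z).PosDef) (hV : S * V + Vᴴ * Sᴴ = 0) :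
    ((defect R Z)⁻¹ * ((R - Zᴴ) * V + Vᴴ * (R - Zᴴ)ᴴ)).trace.re
      + t * (-Complex.I • (S * V)).trace.re = 0 := by
  have hd := hasDerivAt_defect R Z V
  have h0 : defect R (Z + (0 : ℝ) • V) = defect R Z := by simp
  have hdet := hasDerivAt_det hd (by rw [h0]; exact hpos.det_pos.ne'.isUnit)
  have hev := eventually_nonneg hd.continuousAt (fun s => isHermitian_defect _ _)
    (by rwa [h0])
  have hmax : IsLocalMax (fun s : ℝ => barrier R S t (Z + s • V)) 0 := by
    filter_upwards [hev] with s hs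
    have : S * (Z + s • V) + (Z + s • V)ᴴ * Sᴴ = 0 := by
      have : S * (Z + s • V) + (Z + s • V)ᴴ * Sᴴ
          = (S * Z + Zᴴ * Sᴴ) + s • (S * V + Vᴴ * Sᴴ) := by
        simp only [conjTranspose_add, conjTranspose_smul, star_trivial, mul_add, add_mul,
          smul_mul_assoc, mul_smul_comm, smul_add]
        abel
      rw [this, hZS, hV, smul_zero, add_zero]
    simpa using hZ (show Z + s • V ∈ _ from ⟨hs, this⟩)
  have hexp : HasDerivAt
      (fun s : ℝ => Real.exp (t * (-Complex.I • (S * (Z + s • V))).trace.re))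
      (Real.exp (t * (-Complex.I • (S * Z)).trace.re) *
        (t * (-Complex.I • (S * V)).trace.re)) 0 := by
    have h (s : ℝ) : (-Complex.I • (S * (Z + s • V))).trace.re =
        (-Complex.I • (S * Z)).trace.re + s * (-Complex.I • (S * V)).trace.re := by
      simp [mul_add, trace_smul, trace_add]
    simp only [h]
    have := ((((hasDerivAt_id (0 : ℝ)).mul_const
      (-Complex.I • (S * V)).trace.re).const_add
        (-Complex.I • (S * Z)).trace.re).const_mul t).exp
    simpa using this
  have hre := (Complex.reCLM.hasFDerivAt.comp_hasDerivAt (0 : ℝ) hdet).mul hexp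
  have hzero := hmax.hasDerivAt_eq_zero hre
  have hdp := hpos.det_pos
  rw [Complex.lt_def] at hdp
  simp only [Complex.zero_re, Complex.zero_im] at hdp
  simp only [zero_smul, add_zero, Function.comp_apply, Complex.reCLM_apply, Complex.mul_re,
    ← hdp.2, zero_mul, sub_zero] at hzero
  have hne := (mul_pos hdp.1 (Real.exp_pos (t * (-Complex.I • (S * Z)).trace.re))).ne'
  refine (mul_eq_zero.1 (Eq.trans ?_ hzero)).resolve_left hne
  ring

/-- A maximiser of the barrier functional solves a perturbed form of `defect R Z ^ 2 = 0`, the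
perturbation being of order `1 / t`. -/
theorem exists_central {R S : Matrix n n ℂ} (hS : IsUnit S.det) (t : ℝ) :
    ∃ Z, (0 ≤ defect R Z ∧ S * Z + Zᴴ * Sᴴ = 0) ∧
      (R - Zᴴ) * (Complex.I • S⁻¹) * defect R Z
        + defect R Z * ((R - Zᴴ) * (Complex.I • S⁻¹))ᴴ
        + t • (defect R Z * defect R Z) = 0 := by
  have h0 : (0 : Matrix n n ℂ) ∈ {Z | 0 ≤ defect R Z ∧ S * Z + Zᴴ * Sᴴ = 0} := by
    simp [defect]
  obtain ⟨Z, ⟨hZ1, hZ2⟩, hmax⟩ := (isCompact_feasible R S).exists_isMaxOn ⟨0, h0⟩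
    (f := barrier R S t) (by
      unfold barrier
      have := continuous_defect R
      fun_prop)
  have hpos : (defect R Z).PosDef := by
    refine (nonneg_iff_posSemidef.1 hZ1).posDef_iff_det_ne_zero.2 fun h => ?_
    have h1 : barrier R S t 0 ≤ barrier R S t Z := hmax h0
    have h2 : barrier R S t 0 = 1 := by simp [barrier, defect]
    have h3 : barrier R S t Z = 0 := by simp [barrier, h]
    linarith
  refine ⟨Z, ⟨hZ1, hZ2⟩, ?_⟩
  set E := defect R Z with hEdef
  set N := (R - Zᴴ) * (Complex.I • S⁻¹) with hN
  have hE : IsUnit E.det := hpos.det_pos.ne'.isUnit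
  have hEH : E⁻¹ᴴ = E⁻¹ := by rw [conjTranspose_nonsing_inv, hpos.1.eq]
  set G := E⁻¹ * N + Nᴴ * E⁻¹ + t • (1 : Matrix n n ℂ) with hG
  have hGH : Gᴴ = G := by
    simp [hG, hEH, conjTranspose_smul]
    abel
  have hSV : S * ((Complex.I • S⁻¹) * G) = Complex.I • G := by
    rw [← mul_assoc, mul_smul_comm, mul_nonsing_inv _ hS, smul_mul_assoc, one_mul]
  have key := stationary_of_isMaxOn_barrier hmax hZ2 hpos (V := (Complex.I • S⁻¹) * G) (by
    rw [← conjTranspose_mul, hSV, conjTranspose_smul, hGH]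
    simp)
  rw [hSV, ← mul_assoc, ← conjTranspose_mul, ← mul_assoc, ← hN, conjTranspose_mul, hGH] at key
  have htr : (Gᴴ * G).trace = 0 := by
    have hnn := (posSemidef_conjTranspose_mul_self G).trace_nonneg
    rw [Complex.le_def] at hnn
    refine Complex.ext ?_ hnn.2.symm
    rw [hGH, Complex.zero_re, ← key]
    have h1 : (E⁻¹ * (G * Nᴴ)).trace = (Nᴴ * E⁻¹ * G).trace := by
      rw [← mul_assoc, trace_mul_comm, ← mul_assoc]
    have h2 : G * G = E⁻¹ * (N * G) + Nᴴ * E⁻¹ * G + t • G := by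
      conv_lhs => enter [1]; rw [hG]
      simp [add_mul, mul_assoc]
    rw [h2, ← hEdef, mul_add E⁻¹, trace_add, trace_add, trace_add, h1, smul_smul]
    simp
  have hG0 : G = 0 := trace_conjTranspose_mul_self_eq_zero_iff.1 htr
  have : E * G * E = 0 := by simp [hG0]
  rw [← this, hG]
  simp only [mul_add, add_mul, mul_assoc, nonsing_inv_mul _ hE, mul_nonsing_inv_cancel_left _ _ hE]
  simp

theorem exists_solution_of_isUnit {R S : Matrix n n ℂ} (hS : IsUnit S.det) :
    ∃ Z, defect R Z = 0 ∧ S * Z + Zᴴ * Sᴴ = 0 := by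
  choose Z hZ hZE using fun m : ℕ => exists_central (R := R) hS (m + 1 : ℝ)
  obtain ⟨W, hW, φ, hφ, hlim⟩ := (isCompact_feasible R S).tendsto_subseq hZ
  refine ⟨W, ?_, hW.2⟩
  set P : Matrix n n ℂ → Matrix n n ℂ := fun Z => (R - Zᴴ) * (Complex.I • S⁻¹) * defect R Z
        + defect R Z * ((R - Zᴴ) * (Complex.I • S⁻¹))ᴴ with hP
  have hc := continuous_defect R
  have hPc : Continuous P := by fun_prop
  have h1 : Filter.Tendsto (fun m => (-((φ m : ℝ) + 1)⁻¹) • P (Z (φ m))) Filter.atTop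
      (nhds ((-(0 : ℝ)) • P W)) := by
    refine Filter.Tendsto.smul (Filter.Tendsto.neg ?_) ((hPc.tendsto W).comp hlim)
    simpa [Function.comp_def] using
      (tendsto_one_div_add_atTop_nhds_zero_nat (𝕜 := ℝ)).comp hφ.tendsto_atTop
  have h2 : Filter.Tendsto (fun m => defect R (Z (φ m)) * defect R (Z (φ m))) Filter.atTop
      (nhds (defect R W * defect R W)) :=
    ((hc.mul hc).tendsto W).comp hlim
  have h3 (m : ℕ) : (-((φ m : ℝ) + 1)⁻¹) • P (Z (φ m)) =
      defect R (Z (φ m)) * defect R (Z (φ m)) := by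
    have hm : (φ m : ℝ) + 1 ≠ 0 := by positivity
    rw [show P (Z (φ m)) = _ from eq_neg_of_add_eq_zero_left (hZE (φ m))]
    simp [smul_smul, hm]
  simp only [h3, neg_zero, zero_smul] at h1
  have h4 := tendsto_nhds_unique h2 h1
  refine conjTranspose_mul_self_eq_zero.1 ?_
  rwa [(isHermitian_defect R W).eq]

/-- Arbitrarily small real scalar perturbations of a matrix are invertible. -/
theorem exists_isUnit_det_add_smul_one (S : Matrix n n ℂ) :
    ∃ c : ℕ → ℝ, Filter.Tendsto c Filter.atTop (nhds 0) ∧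
      ∀ m, IsUnit (S + c m • (1 : Matrix n n ℂ)).det := by
  have hfin : {c : ℝ | (S + c • (1 : Matrix n n ℂ)).det = 0}.Finite := by
    refine ((-S).charpoly.roots.toFinset.finite_toSet.preimage
      (Complex.ofReal_injective.injOn)).subset fun c hc => ?_
    have hc' : (S + c • (1 : Matrix n n ℂ)).det = 0 := hc
    simp only [Set.mem_preimage, Finset.mem_coe, Multiset.mem_toFinset]
    rw [Polynomial.mem_roots (charpoly_monic _).ne_zero, Polynomial.IsRoot, eval_charpoly, ← hc']
    congr 1
    ext i j
    simp [scalar_apply, diagonal_apply, one_apply, add_comm]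
  have hd := hfin.countable.dense_compl ℝ
  obtain ⟨c, hc, hlim⟩ := mem_closure_iff_seq_limit.1 (hd 0)
  exact ⟨c, hlim, fun m => isUnit_iff_ne_zero.2 (hc m)⟩

theorem exists_solution (R S : Matrix n n ℂ) :
    ∃ Z, defect R Z = 0 ∧ S * Z + Zᴴ * Sᴴ = 0 := by
  obtain ⟨c, hc, hu⟩ := exists_isUnit_det_add_smul_one S
  choose Z hZ hZS using fun m => exists_solution_of_isUnit (R := R) (hu m)
  obtain ⟨W, -, φ, hφ, hlim⟩ := tendsto_subseq_of_bounded (isBounded_defect_nonneg R)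
    (fun m => (hZ m).ge)
  refine ⟨W, ?_, ?_⟩
  · have h := ((continuous_defect R).tendsto W).comp hlim
    simp only [Function.comp_def, hZ] at h
    exact tendsto_nhds_unique h tendsto_const_nhds
  · have h1 : Continuous (fun p : ℝ × Matrix n n ℂ =>
      (S + p.1 • (1 : Matrix n n ℂ)) * p.2
        + p.2ᴴ * (S + p.1 • (1 : Matrix n n ℂ))ᴴ) := by fun_prop
    have h := (h1.tendsto (0, W)).comp ((hc.comp hφ.tendsto_atTop).prodMk_nhds hlim)
    simp only [Function.comp_def, hZS, zero_smul, add_zero] at h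
    exact tendsto_nhds_unique h tendsto_const_nhds

end CommonSolutionPair

/-- For any `R, S ∈ M_k(ℂ)` the system `I + RZ + Z*R* - Z*Z = 0`, `SZ + Z*S* = 0`
has a common solution. -/
theorem exists_common_solution_pair {k : ℕ} (R S : Matrix (Fin k) (Fin k) ℂ) :
    ∃ Z : Matrix (Fin k) (Fin k) ℂ,
      1 + R * Z + Zᴴ * Rᴴ - Zᴴ * Z = 0 ∧ S * Z + Zᴴ * Sᴴ = 0 := by
  exact CommonSolutionPair.exists_solution R S
end

section
/- Let R, S be k×k complex matrices. Then there exists a k×k complex matrix Z satisfying simultaneously I_k + RZ + Z*R* − Z*Z = 0 and I_k + SZ + Z*S* − Z*Z = 0. -/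
open Matrix

open scoped ComplexOrder MatrixOrder Matrix.Norms.L2Operator Topology

namespace Matrix

variable {n : Type*} [Fintype n] [DecidableEq n]

lemma differentiable_det : Differentiable ℝ (det : Matrix n n ℂ → ℂ) := by
  have entry (i j : n) : Differentiable ℝ fun M : Matrix n n ℂ ↦ M i j :=
    ((entryLinearMap ℝ ℂ i j).toContinuousLinearMap).differentiable
  simp only [funext det_apply, Units.smul_def]
  fun_prop

/-- Jacobi's formula at an invertible matrix. -/
lemma hasDerivAt_det {f : ℝ → Matrix n n ℂ} {A : Matrix n n ℂ} {t : ℝ}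
    (hf : HasDerivAt f A t) (ht : IsUnit (f t).det) :
    HasDerivAt (fun s ↦ (f s).det) ((f t).det * ((f t)⁻¹ * A).trace) t := by
  have at_one (B : Matrix n n ℂ) : fderiv ℝ det (1 : Matrix n n ℂ) B = B.trace := by
    have line : HasDerivAt (fun s : ℝ ↦ (1 : Matrix n n ℂ) + s • B) B 0 := by
      simpa using ((hasDerivAt_id (0 : ℝ)).smul_const B).const_add (1 : Matrix n n ℂ)
    have h₁ := (show HasFDerivAt det (fderiv ℝ det (1 : Matrix n n ℂ)) (1 + (0 : ℝ) • B) by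
      simpa using (differentiable_det (1 : Matrix n n ℂ)).hasFDerivAt).comp_hasDerivAt 0 line
    set p := (det (1 + (Polynomial.X : Polynomial ℂ) • B.map Polynomial.C)).divX.divX with hp
    have h₂ : HasDerivAt (fun z : ℂ ↦ 1 + B.trace * z + p.eval z * z ^ 2) B.trace 0 := by
      have := (((hasDerivAt_id (0 : ℂ)).const_mul B.trace).const_add 1).add
        ((p.hasDerivAt 0).mul ((hasDerivAt_id (0 : ℂ)).pow 2))
      simpa [Pi.add_def, Pi.mul_def, Pi.pow_def] using this
    have h₃ := (show HasDerivAt (fun z : ℂ ↦ 1 + B.trace * z + p.eval z * z ^ 2) B.trace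
      ((0 : ℝ) : ℂ) by simpa using h₂).comp_ofReal
    refine h₁.unique (h₃.congr_of_eventuallyEq (.of_forall fun s ↦ ?_))
    simp only [Function.comp, hp, ← det_one_add_smul, Complex.coe_smul]
  have hg : HasDerivAt (fun s ↦ (f t)⁻¹ * f s) ((f t)⁻¹ * A) t := hf.const_mul _
  have h := (show HasFDerivAt det (fderiv ℝ det (1 : Matrix n n ℂ)) ((f t)⁻¹ * f t) by
    rw [nonsing_inv_mul _ ht]
    exact (differentiable_det (1 : Matrix n n ℂ)).hasFDerivAt).comp_hasDerivAt t hg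
  rw [at_one] at h
  refine (h.const_mul (f t).det).congr_of_eventuallyEq (.of_forall fun s ↦ ?_)
  simp only [Function.comp]
  rw [← det_mul, mul_nonsing_inv_cancel_left _ _ ht]

lemma PosDef.eventually_nonneg {W : Matrix n n ℂ} (hW : W.PosDef) :
    ∀ᶠ X in 𝓝 W, X.IsHermitian → 0 ≤ X := by
  rcases subsingleton_or_nontrivial (Matrix n n ℂ) with _ | _
  · exact .of_forall fun X _ ↦ (Subsingleton.elim 0 X).le
  have hW' := hW.isStrictlyPositive
  obtain ⟨r, hr, hrW⟩ : ∃ r > 0, algebraMap ℝ (Matrix n n ℂ) r ≤ W :=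
    (CFC.exists_pos_algebraMap_le_iff hW'.isSelfAdjoint).2 fun x hx ↦ hW'.spectrum_pos hx
  filter_upwards [Metric.ball_mem_nhds W hr] with X hX hXh
  have h₁ : IsSelfAdjoint (X - W) := IsSelfAdjoint.sub hXh hW.isHermitian
  have h₂ : algebraMap ℝ (Matrix n n ℂ) ‖X - W‖ ≤ algebraMap ℝ (Matrix n n ℂ) r :=
    algebraMap_mono _ (by simpa [dist_eq_norm] using (Metric.mem_ball.1 hX).le)
  have h₃ := h₁.neg_algebraMap_norm_le_self
  calc (0 : Matrix n n ℂ) ≤ W - algebraMap ℝ _ r := sub_nonneg.2 hrW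
    _ ≤ W - algebraMap ℝ _ ‖X - W‖ := sub_le_sub_left h₂ _
    _ = W + -algebraMap ℝ _ ‖X - W‖ := sub_eq_add_neg _ _
    _ ≤ W + (X - W) := add_le_add_right h₃ _
    _ = X := by abel

/-- `1 + R R* - (Z - R*)* (Z - R*)`, in expanded form. -/
def sphereDefect (R Z : Matrix n n ℂ) : Matrix n n ℂ := 1 + R * Z + Zᴴ * Rᴴ - Zᴴ * Z

lemma isHermitian_sphereDefect (R Z : Matrix n n ℂ) : (sphereDefect R Z).IsHermitian := by
  simp [IsHermitian, sphereDefect]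
  abel

@[fun_prop]
lemma continuous_sphereDefect (R : Matrix n n ℂ) : Continuous (sphereDefect R) := by
  unfold sphereDefect
  fun_prop

lemma norm_sub_conjTranspose_le {R Z : Matrix n n ℂ} (h : 0 ≤ sphereDefect R Z) :
    ‖Z - Rᴴ‖ ≤ ‖1 + R * Rᴴ‖ + 1 := by
  have e : (Z - Rᴴ)ᴴ * (Z - Rᴴ) = 1 + R * Rᴴ - sphereDefect R Z := by
    simp [sphereDefect]
    noncomm_ring
  have h₀ : 0 ≤ (Z - Rᴴ)ᴴ * (Z - Rᴴ) := (posSemidef_conjTranspose_mul_self _).nonneg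
  have h₁ := CStarAlgebra.norm_le_norm_of_nonneg_of_le h₀ (e ▸ sub_le_self _ h)
  rw [← star_eq_conjTranspose, CStarRing.norm_star_mul_self] at h₁
  nlinarith [norm_nonneg (Z - Rᴴ)]

lemma sphereDefect_add_smul (R Z E : Matrix n n ℂ) (t : ℝ) :
    sphereDefect R (Z + t • E) =
      sphereDefect R Z + t • ((R - Zᴴ) * E + ((R - Zᴴ) * E)ᴴ) - t ^ 2 • (Eᴴ * E) := by
  simp only [sphereDefect, conjTranspose_add, conjTranspose_smul, conjTranspose_mul,
    conjTranspose_sub, conjTranspose_conjTranspose, star_trivial, mul_add, add_mul, sub_mul,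
    smul_add, smul_sub, mul_smul_comm, smul_mul_assoc, smul_smul, pow_two]
  abel

/-- Maximising `exp (c * Im tr (D Z)) * det W(Z)` over the `Z` with `D Z` skew-Hermitian and
`W(Z)` positive semidefinite, where `W` is `sphereDefect R`. -/
lemma exists_maximizer (R D : Matrix n n ℂ) (c : ℝ) :
    ∃ Z, (D * Z)ᴴ = -(D * Z) ∧ (sphereDefect R Z).PosDef ∧
      ∀ Z', (D * Z')ᴴ = -(D * Z') → 0 ≤ sphereDefect R Z' →
        Real.exp (c * (D * Z').trace.im) * (sphereDefect R Z').det.re ≤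
          Real.exp (c * (D * Z).trace.im) * (sphereDefect R Z).det.re := by
  let K : Set (Matrix n n ℂ) := {Z | (D * Z)ᴴ = -(D * Z) ∧ 0 ≤ sphereDefect R Z}
  have closed : IsClosed K := by
    refine (isClosed_eq (by fun_prop) (by fun_prop)).inter ?_
    exact isClosed_le continuous_const (continuous_sphereDefect R)
  have bounded : Bornology.IsBounded K :=
    Metric.isBounded_closedBall.subset fun Z hZ ↦
      mem_closedBall_iff_norm.2 (norm_sub_conjTranspose_le hZ.2)
  have : ProperSpace (Matrix n n ℂ) := FiniteDimensional.proper ℂ _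
  have compact : IsCompact K := Metric.isCompact_of_isClosed_isBounded closed bounded
  have zero_mem : (0 : Matrix n n ℂ) ∈ K := by
    refine ⟨by simp, ?_⟩
    simp [sphereDefect]
  obtain ⟨Z, hZ, hmax⟩ := compact.exists_isMaxOn ⟨0, zero_mem⟩
    (f := fun Z ↦ Real.exp (c * (D * Z).trace.im) * (sphereDefect R Z).det.re)
    (Continuous.continuousOn (by fun_prop))
  refine ⟨Z, hZ.1, ?_, fun Z' h₁ h₂ ↦ hmax ⟨h₁, h₂⟩⟩
  rw [hZ.2.posSemidef.posDef_iff_det_ne_zero]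
  intro h
  have := hmax zero_mem
  simp [sphereDefect] at this
  simp [sphereDefect] at h
  norm_num [h] at this

lemma trace_eq_zero_of_maximizer {R D Z : Matrix n n ℂ} {c : ℝ} (hZ : (D * Z)ᴴ = -(D * Z))
    (hW : (sphereDefect R Z).PosDef)
    (hmax : ∀ Z', (D * Z')ᴴ = -(D * Z') → 0 ≤ sphereDefect R Z' →
      Real.exp (c * (D * Z').trace.im) * (sphereDefect R Z').det.re ≤
        Real.exp (c * (D * Z).trace.im) * (sphereDefect R Z).det.re)
    {E : Matrix n n ℂ} (hE : (D * E)ᴴ = -(D * E)) :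
    c * (D * E).trace.im +
      ((sphereDefect R Z)⁻¹ * ((R - Zᴴ) * E + ((R - Zᴴ) * E)ᴴ)).trace.re = 0 := by
  set W := sphereDefect R Z with hW_def
  set Δ := (R - Zᴴ) * E + ((R - Zᴴ) * E)ᴴ with hΔ
  have hf : HasDerivAt (fun t : ℝ ↦ sphereDefect R (Z + t • E)) Δ 0 := by
    simp only [sphereDefect_add_smul]
    have := (((hasDerivAt_id (0 : ℝ)).smul_const Δ).const_add W).sub
      (((hasDerivAt_id (0 : ℝ)).pow 2).smul_const (Eᴴ * E))
    simp only [← hΔ, ← hW_def]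
    simpa [Pi.sub_def, -conjTranspose_mul, -conjTranspose_sub] using this
  have h0 : sphereDefect R (Z + (0 : ℝ) • E) = W := by simp [hW_def]
  have det_pos := Complex.pos_iff.1 hW.det_pos
  have hdet := hasDerivAt_det hf (by rw [h0]; exact hW.det_pos.ne'.isUnit)
  rw [h0] at hdet
  have hre := Complex.reCLM.hasFDerivAt.comp_hasDerivAt (0 : ℝ) hdet
  have hexp : HasDerivAt (fun t : ℝ ↦ Real.exp (c * (D * (Z + t • E)).trace.im))
      (Real.exp (c * (D * Z).trace.im) * (c * (D * E).trace.im)) 0 := by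
    have := ((((hasDerivAt_id (0 : ℝ)).mul_const (D * E).trace.im).const_add
      (D * Z).trace.im).const_mul c).exp
    simpa [mul_add] using this
  have hlocal : IsLocalMax (fun t : ℝ ↦ Real.exp (c * (D * (Z + t • E)).trace.im) *
      (sphereDefect R (Z + t • E)).det.re) 0 := by
    have tend := hf.continuousAt.tendsto
    rw [h0] at tend
    filter_upwards [tend.eventually hW.eventually_nonneg] with t ht
    have := hmax (Z + t • E) ?_ (ht (isHermitian_sphereDefect _ _))
    · simpa [← hW_def] using this
    · rw [mul_add, mul_smul_comm, conjTranspose_add, conjTranspose_smul, hZ, hE, star_trivial,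
        neg_add, smul_neg]
  have hzero := hlocal.hasDerivAt_eq_zero (hexp.mul hre)
  simp only [zero_smul, add_zero, Complex.reCLM_apply, Complex.mul_re,
    ← det_pos.2, zero_mul, sub_zero] at hzero
  have hpos := mul_pos (Real.exp_pos (c * (D * Z).trace.im)) det_pos.1
  refine (mul_eq_zero.1 ?_).resolve_left hpos.ne'
  linear_combination hzero

lemma exists_small_sphereDefect (R : Matrix n n ℂ) {D : Matrix n n ℂ} (hD : IsUnit D.det)
    (c : ℝ) (hc : 0 < c) :
    ∃ Z, (D * Z)ᴴ = -(D * Z) ∧ 0 ≤ sphereDefect R Z ∧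
      c * ‖sphereDefect R Z‖ ≤ 2 * (‖R - Zᴴ‖ * ‖D⁻¹‖) := by
  obtain ⟨Z, hZ, hW, hmax⟩ := exists_maximizer R D c
  refine ⟨Z, hZ, hW.posSemidef.nonneg, ?_⟩
  have key {E : Matrix n n ℂ} := trace_eq_zero_of_maximizer (E := E) hZ hW hmax
  set W := sphereDefect R Z
  set G := (R - Zᴴ) * D⁻¹ with hG
  set M : Matrix n n ℂ := c • 1 + Complex.I • (W⁻¹ * G) - Complex.I • (Gᴴ * W⁻¹) with hM
  have hWdet : IsUnit W.det := hW.det_pos.ne'.isUnit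
  have hWh : Wᴴ = W := hW.isHermitian
  have hMh : Mᴴ = M := by
    simp [hM, conjTranspose_nonsing_inv, hWh]
    abel
  have hDE : D * (Complex.I • (D⁻¹ * M)) = Complex.I • M := by
    rw [mul_smul_comm, mul_nonsing_inv_cancel_left _ _ hD]
  have hRE : (R - Zᴴ) * (Complex.I • (D⁻¹ * M)) = Complex.I • (G * M) := by
    rw [mul_smul_comm, hG, mul_assoc]
  have h := key (E := Complex.I • (D⁻¹ * M)) (by
    rw [hDE, conjTranspose_smul, hMh]
    simp)
  rw [hDE, hRE] at h
  have htr : (M * M).trace = c * M.trace +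
      (W⁻¹ * (Complex.I • (G * M) + (Complex.I • (G * M))ᴴ)).trace := by
    have cyc : (W⁻¹ * (M * Gᴴ)).trace = (Gᴴ * (W⁻¹ * M)).trace := by
      rw [← mul_assoc, trace_mul_comm]
    nth_rewrite 1 [hM]
    simp only [conjTranspose_smul, conjTranspose_mul, hMh, mul_add, add_mul, sub_mul, trace_add,
      trace_sub, mul_smul_comm, smul_mul, trace_smul, cyc, one_mul, mul_assoc]
    simp
    ring
  have hre : (M * M).trace.re = 0 := by
    rw [htr]
    simpa using h
  have hM0 : M = 0 := by
    rw [← trace_conjTranspose_mul_self_eq_zero_iff, hMh]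
    have := Complex.nonneg_iff.1 ((posSemidef_conjTranspose_mul_self M).trace_nonneg)
    rw [hMh] at this
    exact Complex.ext hre this.2.symm
  have hWW : c • (W * W) = Complex.I • (W * Gᴴ) - Complex.I • (G * W) := by
    have : W * M * W = 0 := by simp [hM0]
    rw [hM] at this
    simp only [mul_add, add_mul, mul_sub, sub_mul, mul_smul_comm, smul_mul, mul_one, mul_assoc,
      nonsing_inv_mul _ hWdet, mul_nonsing_inv_cancel_left _ _ hWdet] at this
    rw [← sub_eq_zero, ← this]
    abel
  have hnorm : c * (‖W‖ * ‖W‖) ≤ 2 * (‖G‖ * ‖W‖) := by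
    calc c * (‖W‖ * ‖W‖) = ‖c • (W * W)‖ := by
          rw [norm_smul, Real.norm_of_nonneg hc.le, ← CStarRing.norm_star_mul_self,
            star_eq_conjTranspose, hWh]
      _ ≤ ‖W‖ * ‖G‖ + ‖G‖ * ‖W‖ := by
          rw [hWW]
          refine (norm_sub_le _ _).trans ?_
          simp only [norm_smul, Complex.norm_I, one_mul]
          gcongr
          · exact (norm_mul_le _ _).trans_eq (by rw [l2_opNorm_conjTranspose])
          · exact norm_mul_le _ _
      _ = 2 * (‖G‖ * ‖W‖) := by ring
  have hGle : ‖G‖ ≤ ‖R - Zᴴ‖ * ‖D⁻¹‖ := norm_mul_le _ _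
  rcases (norm_nonneg W).eq_or_lt with h0 | hpos
  · rw [← h0, mul_zero]
    positivity
  · have : c * ‖W‖ ≤ 2 * ‖G‖ := by
      refine le_of_mul_le_mul_right ?_ hpos
      linarith
    linarith

lemma exists_isUnit_det_add_smul (D : Matrix n n ℂ) {ε : ℝ} (hε : 0 < ε) :
    ∃ z : ℂ, ‖z‖ < ε ∧ IsUnit (D + z • (1 : Matrix n n ℂ)).det := by
  have hinf : (Metric.ball (0 : ℂ) ε).Infinite :=
    infinite_of_mem_nhds 0 (Metric.ball_mem_nhds 0 hε)
  obtain ⟨z, hz, hzD⟩ := (hinf.sdiff (-D).finite_spectrum).nonempty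
  refine ⟨z, by simpa using hz, ?_⟩
  rw [← isUnit_iff_isUnit_det]
  simpa [spectrum.mem_iff, Algebra.algebraMap_eq_smul_one, add_comm] using hzD

lemma exists_sphereDefect_eq_zero (R D : Matrix n n ℂ) :
    ∃ Z, (D * Z)ᴴ = -(D * Z) ∧ sphereDefect R Z = 0 := by
  set B := ‖1 + R * Rᴴ‖ + 1
  have hB : 0 < B := by positivity
  have approx (m : ℕ) : ∃ (z : ℂ) (Z : Matrix n n ℂ), ‖z‖ ≤ 1 / ((m : ℝ) + 1) ∧
      ‖Z - Rᴴ‖ ≤ B ∧ ((D + z • 1) * Z)ᴴ = -((D + z • 1) * Z) ∧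
      ‖sphereDefect R Z‖ ≤ 1 / ((m : ℝ) + 1) := by
    have hm : 0 < 1 / ((m : ℝ) + 1) := by positivity
    obtain ⟨z, hz, hD⟩ := exists_isUnit_det_add_smul D hm
    set N := ‖(D + z • (1 : Matrix n n ℂ))⁻¹‖
    have hN : 0 ≤ N := norm_nonneg _
    obtain ⟨Z, hZ, hnonneg, hle⟩ := exists_small_sphereDefect R hD
      ((2 * (B * N) + 1) * (m + 1)) (by positivity)
    have hZB := norm_sub_conjTranspose_le hnonneg
    refine ⟨z, Z, hz.le, hZB, hZ, ?_⟩
    have hRZ : ‖R - Zᴴ‖ ≤ B := by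
      rwa [← l2_opNorm_conjTranspose, conjTranspose_sub, conjTranspose_conjTranspose,
        norm_sub_rev]
    have : 2 * (‖R - Zᴴ‖ * N) ≤ 2 * (B * N) + 1 := by
      nlinarith [mul_le_mul_of_nonneg_right hRZ hN]
    rw [le_div_iff₀ (by positivity)]
    have hpos : 0 < 2 * (B * N) + 1 := by positivity
    refine le_of_mul_le_mul_left ?_ hpos
    linarith
  choose z Z hz hZB hskew hsmall using approx
  have : ProperSpace (Matrix n n ℂ) := FiniteDimensional.proper ℂ _
  obtain ⟨Z₀, -, φ, hφ, hlim⟩ := (isCompact_closedBall Rᴴ B).tendsto_subseq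
    (x := Z) fun m ↦ mem_closedBall_iff_norm.2 (hZB m)
  have hzlim : Filter.Tendsto (z ∘ φ) Filter.atTop (𝓝 0) :=
    (squeeze_zero_norm hz tendsto_one_div_add_atTop_nhds_zero_nat).comp hφ.tendsto_atTop
  have hWlim : Filter.Tendsto (fun m ↦ sphereDefect R (Z (φ m))) Filter.atTop (𝓝 0) :=
    (squeeze_zero_norm hsmall tendsto_one_div_add_atTop_nhds_zero_nat).comp hφ.tendsto_atTop
  have hDZ : Filter.Tendsto (fun m ↦ (D + z (φ m) • 1) * Z (φ m)) Filter.atTop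
      (𝓝 (D * Z₀)) := by
    simpa using ((hzlim.smul_const (1 : Matrix n n ℂ)).const_add D).mul hlim
  refine ⟨Z₀, tendsto_nhds_unique ?_ hDZ.neg, tendsto_nhds_unique
    ((continuous_sphereDefect R).continuousAt.tendsto.comp hlim) hWlim⟩
  simp_rw [← hskew]
  exact hDZ.star

end Matrix

/-- For any `R, S ∈ M_k(ℂ)` the two equations `I + RZ + Z*R* - Z*Z = 0` and
`I + SZ + Z*S* - Z*Z = 0` have a common solution. -/
theorem exists_common_solution_two_spheres {k : ℕ} (R S : Matrix (Fin k) (Fin k) ℂ) :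
    ∃ Z : Matrix (Fin k) (Fin k) ℂ,
      1 + R * Z + Zᴴ * Rᴴ - Zᴴ * Z = 0 ∧ 1 + S * Z + Zᴴ * Sᴴ - Zᴴ * Z = 0 := by
  obtain ⟨Z, hskew, hR⟩ := exists_sphereDefect_eq_zero R (S - R)
  refine ⟨Z, hR, ?_⟩
  rw [sphereDefect] at hR
  have h : (S - R) * Z + ((S - R) * Z)ᴴ = 0 := by rw [hskew, add_neg_cancel]
  calc 1 + S * Z + Zᴴ * Sᴴ - Zᴴ * Z
      = (1 + R * Z + Zᴴ * Rᴴ - Zᴴ * Z) + ((S - R) * Z + ((S - R) * Z)ᴴ) := by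
        simp only [conjTranspose_mul, conjTranspose_sub]
        noncomm_ring
    _ = 0 := by rw [hR, h, add_zero]
end

section
/- Let R, P be k×k complex matrices with P positive definite, and let γ be a real number. Then there exists a Hermitian k×k matrix H such that I_k + RH + HR* − HPH = γH. -/
open Matrix
open scoped ComplexOrder

section Riccati

open Filter Topology
open scoped MatrixOrder Matrix.Norms.L2Operator

variable {n : Type*} [Fintype n] [DecidableEq n]

/-- The Riccati operator `H ↦ I + AH + HA* - HPH`. -/
def riccatiMap (A P H : Matrix n n ℂ) : Matrix n n ℂ :=
  1 + A * H + H * Aᴴ - H * P * H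

theorem riccatiMap_zero (A P : Matrix n n ℂ) : riccatiMap A P 0 = 1 := by
  simp [riccatiMap]

theorem continuous_riccatiMap (A P : Matrix n n ℂ) : Continuous (riccatiMap A P) := by
  unfold riccatiMap
  fun_prop

theorem isHermitian_riccatiMap {A P H : Matrix n n ℂ} (hP : P.IsHermitian)
    (hH : H.IsHermitian) : (riccatiMap A P H).IsHermitian := by
  simp only [IsHermitian, riccatiMap, conjTranspose_sub, conjTranspose_add, conjTranspose_one,
    conjTranspose_mul, conjTranspose_conjTranspose, hP.eq, hH.eq, Matrix.mul_assoc]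
  abel

theorem riccatiMap_add_smul (A P H D : Matrix n n ℂ) (t : ℂ) :
    riccatiMap A P (H + t • D) = riccatiMap A P H
      + t • ((A - H * P) * D + D * (Aᴴ - P * H)) - t ^ 2 • (D * P * D) := by
  simp only [riccatiMap, Matrix.mul_add, Matrix.add_mul, Matrix.mul_sub, Matrix.sub_mul,
    Matrix.mul_smul, Matrix.smul_mul, smul_add, smul_sub, smul_smul, pow_two, Matrix.mul_assoc]
  abel

/-- The derivative of the determinant at the identity is the trace. -/
theorem hasDerivAt_det_of_eq_one {M : ℂ → Matrix n n ℂ} {M' : Matrix n n ℂ} {t₀ : ℂ}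
    (hM : HasDerivAt M M' t₀) (h₀ : M t₀ = 1) :
    HasDerivAt (fun t => (M t).det) M'.trace t₀ := by
  have hentry : ∀ i j, Differentiable ℂ fun X : Matrix n n ℂ => X i j := fun i j =>
    (LinearMap.toContinuousLinearMap (Matrix.entryLinearMap ℂ ℂ i j)).differentiable
  have hdet : Differentiable ℂ fun X : Matrix n n ℂ => X.det := by
    simp only [Matrix.det_apply']
    fun_prop
  have hd := (hdet 1).hasFDerivAt
  have hcomp : HasDerivAt (fun t => (M t).det)
      (fderiv ℂ (fun X : Matrix n n ℂ => X.det) 1 M') t₀ :=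
    HasFDerivAt.comp_hasDerivAt t₀ (by rw [h₀]; exact hd) hM
  have hline : HasDerivAt (fun t : ℂ => 1 + t • M') M' 0 := by
    simpa using ((hasDerivAt_id (0 : ℂ)).smul_const M').const_add 1
  have h1 : HasDerivAt (fun t : ℂ => (1 + t • M').det)
      (fderiv ℂ (fun X : Matrix n n ℂ => X.det) 1 M') 0 :=
    HasFDerivAt.comp_hasDerivAt (f := fun t : ℂ => 1 + t • M') 0
      (show HasFDerivAt _ _ (1 + (0 : ℂ) • M') by rw [zero_smul, add_zero]; exact hd) hline
  have h2 : HasDerivAt (fun t : ℂ => (1 + t • M').det) M'.trace 0 := by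
    obtain ⟨p, hp⟩ : ∃ p : Polynomial ℂ, ∀ t : ℂ,
        (1 + t • M').det = 1 + M'.trace * t + p.eval t * t ^ 2 :=
      ⟨_, fun t => Matrix.det_one_add_smul t M'⟩
    rw [funext hp]
    exact ((((hasDerivAt_id (0 : ℂ)).const_mul M'.trace).const_add 1).add
      ((p.hasDerivAt 0).mul ((hasDerivAt_id (0 : ℂ)).pow 2))).congr_deriv (by simp)
  rw [← h1.unique h2]
  exact hcomp

theorem nonneg_of_norm_sub_one_le {X : Matrix n n ℂ} (hX : X.IsHermitian)
    (h : ‖X - 1‖ ≤ 1) : 0 ≤ X := by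
  have hs : IsSelfAdjoint (X - 1) := (hX.sub isHermitian_one).isSelfAdjoint
  have h1 := hs.neg_algebraMap_norm_le_self
  have h2 : algebraMap ℝ (Matrix n n ℂ) ‖X - 1‖ ≤ 1 := by
    simpa using algebraMap_mono (Matrix n n ℂ) h
  have h3 : -1 ≤ X - 1 := (neg_le_neg h2).trans h1
  simpa using add_le_add_left h3 1

theorem exists_isUnit_conjTranspose_mul_self {S : Matrix n n ℂ} (hS : S.PosDef) :
    ∃ T : Matrix n n ℂ, IsUnit T ∧ S = Tᴴ * T := by
  obtain ⟨T, rfl⟩ := CStarAlgebra.nonneg_iff_eq_star_mul_self.mp hS.posSemidef.nonneg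
  refine ⟨T, ?_, rfl⟩
  have := hS.isUnit
  rw [Matrix.isUnit_iff_isUnit_det, Matrix.det_mul] at this
  exact (Matrix.isUnit_iff_isUnit_det _).mpr (isUnit_of_mul_isUnit_right this)

theorem eventually_nonneg_of_posDef {α : Type*} [TopologicalSpace α] {E : α → Matrix n n ℂ}
    {a : α} (hE : ContinuousAt E a) (hH : ∀ t, (E t).IsHermitian) (ha : (E a).PosDef) :
    ∀ᶠ t in 𝓝 a, 0 ≤ E t := by
  obtain ⟨T, hT, hST⟩ := exists_isUnit_conjTranspose_mul_self ha
  have hdet := (Matrix.isUnit_iff_isUnit_det _).mp hT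
  have hdet' : IsUnit Tᴴ.det := by rw [det_conjTranspose]; exact hdet.star
  have hc : ContinuousAt (fun t => ‖(T⁻¹)ᴴ * E t * T⁻¹ - 1‖) a := by fun_prop
  have h0 : ‖(T⁻¹)ᴴ * E a * T⁻¹ - 1‖ < 1 := by
    have : (T⁻¹)ᴴ * E a * T⁻¹ = 1 := by
      rw [hST, conjTranspose_nonsing_inv, ← Matrix.mul_assoc, Matrix.nonsing_inv_mul _ hdet',
        Matrix.one_mul, Matrix.mul_nonsing_inv _ hdet]
    simp [this]
  filter_upwards [hc.eventually_lt_const h0] with t ht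
  have h1 := nonneg_of_norm_sub_one_le
    (isHermitian_conjTranspose_mul_mul (T⁻¹) (hH t)) ht.le
  have h2 := (h1.posSemidef.conjTranspose_mul_mul_same T).nonneg
  have : Tᴴ * ((T⁻¹)ᴴ * E t * T⁻¹) * T = E t := by
    rw [conjTranspose_nonsing_inv]
    simp only [Matrix.mul_assoc, Matrix.nonsing_inv_mul _ hdet, Matrix.mul_one]
    rw [← Matrix.mul_assoc, Matrix.mul_nonsing_inv _ hdet', Matrix.one_mul]
  rwa [this] at h2

/-- The Hermitian matrices satisfying the Riccati inequality. -/
def riccatiSet (A P : Matrix n n ℂ) : Set (Matrix n n ℂ) :=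
  {H | H.IsHermitian ∧ 0 ≤ riccatiMap A P H}

theorem zero_mem_riccatiSet (A P : Matrix n n ℂ) : 0 ∈ riccatiSet A P :=
  ⟨isHermitian_zero, by rw [riccatiMap_zero]; exact zero_le_one⟩

theorem le_add_one_of_sq_le {x b d : ℝ} (hb : 0 ≤ b) (hd : 0 ≤ d) (h : x ^ 2 ≤ b * x + d) :
    x ≤ b + d + 1 := by
  by_contra! hx
  nlinarith

theorem isCompact_riccatiSet (A : Matrix n n ℂ) {P : Matrix n n ℂ} (hP : P.PosDef) :
    IsCompact (riccatiSet A P) := by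
  have : ProperSpace (Matrix n n ℂ) := FiniteDimensional.proper ℂ _
  refine Metric.isCompact_of_isClosed_isBounded ?_ ?_
  · exact (isClosed_eq (by fun_prop) continuous_id).inter
      (CStarAlgebra.isClosed_nonneg.preimage (continuous_riccatiMap A P))
  obtain ⟨T, hT, rfl⟩ := exists_isUnit_conjTranspose_mul_self hP
  have hdet := (Matrix.isUnit_iff_isUnit_det _).mp hT
  set c := ‖T⁻¹‖ ^ 2
  have hc : 0 ≤ c := by positivity
  set o := ‖(1 : Matrix n n ℂ)‖
  have ho : 0 ≤ o := norm_nonneg _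
  rw [isBounded_iff_forall_norm_le]
  refine ⟨c * o + 2 * c * ‖A‖ + 1, fun H ⟨hH, hF⟩ => ?_⟩
  have h1 : (T * H)ᴴ * (T * H) ≤ 1 + A * H + H * Aᴴ := by
    have : riccatiMap A (Tᴴ * T) H = 1 + A * H + H * Aᴴ - (T * H)ᴴ * (T * H) := by
      simp only [riccatiMap, conjTranspose_mul, hH.eq, Matrix.mul_assoc]
    rw [this] at hF
    exact sub_nonneg.mp hF
  have h2 := CStarAlgebra.norm_le_norm_of_nonneg_of_le
    (posSemidef_conjTranspose_mul_self (T * H)).nonneg h1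
  rw [l2_opNorm_conjTranspose_mul_self] at h2
  have h3 : ‖1 + A * H + H * Aᴴ‖ ≤ o + 2 * ‖A‖ * ‖H‖ := by
    have e1 := norm_mul_le A H
    have e2 := norm_mul_le H Aᴴ
    rw [l2_opNorm_conjTranspose] at e2
    have e3 := norm_add₃_le (a := (1 : Matrix n n ℂ)) (b := A * H) (c := H * Aᴴ)
    linarith
  have h4 : ‖H‖ ≤ ‖T⁻¹‖ * ‖T * H‖ := by
    have := norm_mul_le T⁻¹ (T * H)
    rwa [← Matrix.mul_assoc, Matrix.nonsing_inv_mul _ hdet, Matrix.one_mul] at this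
  have h5 : ‖H‖ ^ 2 ≤ c * (o + 2 * ‖A‖ * ‖H‖) := by
    calc ‖H‖ ^ 2 ≤ (‖T⁻¹‖ * ‖T * H‖) ^ 2 := by gcongr
      _ = c * (‖T * H‖ * ‖T * H‖) := by ring
      _ ≤ _ := by gcongr; exact h2.trans h3
  linarith [le_add_one_of_sq_le (x := ‖H‖) (b := 2 * c * ‖A‖) (d := c * o) (by positivity)
    (by positivity) (h5.trans_eq (by ring))]

/-- A maximizer of `exp (r tr H) det F(H)`, with `F` the Riccati operator, is an interior point of
the Riccati set, and its first-order condition is a quadratic equation for `F(H)`. -/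
theorem exists_mem_riccatiSet_smul_sq_eq (A : Matrix n n ℂ) {P : Matrix n n ℂ} (hP : P.PosDef)
    (r : ℝ) : ∃ H ∈ riccatiSet A P, (r : ℂ) • (riccatiMap A P H * riccatiMap A P H) =
      -((A - H * P) * riccatiMap A P H + riccatiMap A P H * (Aᴴ - P * H)) := by
  have hcont : Continuous fun H : Matrix n n ℂ =>
      Real.exp (r * H.trace.re) * (riccatiMap A P H).det.re := by
    have := continuous_riccatiMap A P
    have h1 : Continuous fun H : Matrix n n ℂ => H.trace := continuous_id.matrix_trace
    have h2 : Continuous fun H : Matrix n n ℂ => (riccatiMap A P H).det := this.matrix_det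
    fun_prop
  obtain ⟨H, hmem, hmax⟩ := (isCompact_riccatiSet A hP).exists_isMaxOn
    ⟨0, zero_mem_riccatiSet A P⟩ hcont.continuousOn
  refine ⟨H, hmem, ?_⟩
  obtain ⟨hH, hF⟩ := hmem
  set S := riccatiMap A P H with hS
  have hdetpos : 0 < S.det.re := by
    have h1 := hmax (zero_mem_riccatiSet A P)
    simp only [Set.mem_ofPred_eq, riccatiMap_zero, trace_zero, det_one, Complex.zero_re,
      Complex.one_re, mul_zero, Real.exp_zero, mul_one] at h1
    exact pos_of_mul_pos_right (one_pos.trans_le h1) (Real.exp_pos _).le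
  have hne : S.det ≠ 0 := fun h => by simp [h] at hdetpos
  have hu : IsUnit S.det := hne.isUnit
  have hSpd : S.PosDef := hF.posSemidef.posDef_iff_det_ne_zero.mpr hne
  have hdetim : S.det.im = 0 := ((Complex.pos_iff.mp hSpd.det_pos).2).symm
  have hstat : ∀ D : Matrix n n ℂ, D.IsHermitian →
      r * D.trace.re + (S⁻¹ * ((A - H * P) * D + D * (Aᴴ - P * H))).trace.re = 0 := by
    intro D hD
    set L := (A - H * P) * D + D * (Aᴴ - P * H)
    have hHt : ∀ t : ℝ, (H + (t : ℂ) • D).IsHermitian := fun t => by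
      simp [IsHermitian, hH.eq, hD.eq]
    have hev : ∀ᶠ t : ℝ in 𝓝 0, H + (t : ℂ) • D ∈ riccatiSet A P := by
      have : ContinuousAt (fun t : ℝ => riccatiMap A P (H + (t : ℂ) • D)) 0 :=
        ((continuous_riccatiMap A P).comp (by fun_prop)).continuousAt
      filter_upwards [eventually_nonneg_of_posDef this
        (fun t => isHermitian_riccatiMap hP.isHermitian (hHt t)) (by simpa using hSpd)] with t ht
      exact ⟨hHt t, ht⟩
    have hloc : IsLocalMax (fun t : ℝ => Real.exp (r * (H + (t : ℂ) • D).trace.re) *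
        (riccatiMap A P (H + (t : ℂ) • D)).det.re) 0 := by
      filter_upwards [hev] with t ht
      simpa using hmax ht
    have hM : HasDerivAt (fun t : ℂ => 1 + t • (S⁻¹ * L) - t ^ 2 • (S⁻¹ * (D * P * D)))
        (S⁻¹ * L) 0 := by
      exact ((((hasDerivAt_id (0 : ℂ)).smul_const (S⁻¹ * L)).const_add 1).sub
        (((hasDerivAt_id (0 : ℂ)).pow 2).smul_const (S⁻¹ * (D * P * D)))).congr_deriv (by simp)
    have hdet : HasDerivAt (fun t : ℂ => (riccatiMap A P (H + t • D)).det)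
        (S.det * (S⁻¹ * L).trace) 0 := by
      have hfac : ∀ t : ℂ, (riccatiMap A P (H + t • D)).det =
          S.det * (1 + t • (S⁻¹ * L) - t ^ 2 • (S⁻¹ * (D * P * D))).det := fun t => by
        rw [← det_mul, riccatiMap_add_smul]
        rw [Matrix.mul_sub S, Matrix.mul_add S, Matrix.mul_one, Matrix.mul_smul, Matrix.mul_smul,
          Matrix.mul_nonsing_inv_cancel_left _ _ hu, Matrix.mul_nonsing_inv_cancel_left _ _ hu]
      rw [funext hfac]
      exact (hasDerivAt_det_of_eq_one hM (by simp)).const_mul S.det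
    have htr : HasDerivAt (fun t : ℂ => (H + t • D).trace) D.trace 0 := by
      simp only [trace_add, trace_smul, smul_eq_mul]
      simpa using ((hasDerivAt_id (0 : ℂ)).mul_const D.trace).const_add H.trace
    have hdet' := HasDerivAt.real_of_complex (z := 0) (by rw [Complex.ofReal_zero]; exact hdet)
    have htr' := HasDerivAt.real_of_complex (z := 0) (by rw [Complex.ofReal_zero]; exact htr)
    have hzero := hloc.hasDerivAt_eq_zero ((htr'.const_mul r).exp.mul hdet')
    simp only [Complex.ofReal_zero, zero_smul, add_zero, ← hS, Complex.mul_re, hdetim, zero_mul,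
      sub_zero] at hzero
    have : Real.exp (r * H.trace.re) * S.det.re * (r * D.trace.re + (S⁻¹ * L).trace.re) = 0 := by
      linarith
    exact (mul_eq_zero.mp this).resolve_left (by positivity)
  set B := A - H * P with hB
  have hBH : Aᴴ - P * H = Bᴴ := by simp [hB, hP.isHermitian.eq, hH.eq]
  rw [hBH] at hstat ⊢
  have hSi : (S⁻¹)ᴴ = S⁻¹ := by rw [conjTranspose_nonsing_inv, hSpd.isHermitian.eq]
  set G := (r : ℂ) • (1 : Matrix n n ℂ) + S⁻¹ * B + Bᴴ * S⁻¹ with hG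
  have hGH : Gᴴ = G := by
    simp only [hG, conjTranspose_add, conjTranspose_smul, conjTranspose_one, conjTranspose_mul,
      conjTranspose_conjTranspose, hSi, Complex.star_def, Complex.conj_ofReal]
    abel
  have htrace : ∀ D : Matrix n n ℂ,
      (G * D).trace = r * D.trace + (S⁻¹ * (B * D + D * Bᴴ)).trace := fun D => by
    rw [hG, Matrix.add_mul, Matrix.add_mul, Matrix.mul_add, trace_add, trace_add, trace_add,
      Matrix.smul_mul, Matrix.one_mul, trace_smul, Matrix.mul_assoc Bᴴ, Matrix.trace_mul_comm Bᴴ,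
      Matrix.mul_assoc, Matrix.mul_assoc, smul_eq_mul, add_assoc]
  have hG0 : G = 0 := by
    have h1 := hstat G hGH
    have h2 : (Gᴴ * G).trace.re = 0 := by
      rw [hGH, htrace, Complex.add_re, Complex.re_ofReal_mul]
      exact h1
    have h3 := (posSemidef_conjTranspose_mul_self G).trace_nonneg
    rw [← trace_conjTranspose_mul_self_eq_zero_iff]
    exact Complex.ext h2 (Complex.nonneg_iff.mp h3).2.symm
  have h4 : S * G * S = 0 := by simp [hG0]
  have h5 : S * G * S = (r : ℂ) • (S * S) + (B * S + S * Bᴴ) := by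
    simp only [hG, Matrix.mul_add, Matrix.add_mul, Matrix.mul_smul, Matrix.smul_mul,
      Matrix.mul_one, Matrix.mul_assoc, Matrix.nonsing_inv_mul _ hu,
      Matrix.mul_nonsing_inv_cancel_left _ _ hu]
    abel
  exact eq_neg_of_add_eq_zero_left (h5.symm.trans h4)

/-- The algebraic Riccati equation `I + AH + HA* - HPH = 0` has a Hermitian solution. -/
theorem exists_isHermitian_riccatiMap_eq_zero (A : Matrix n n ℂ) {P : Matrix n n ℂ}
    (hP : P.PosDef) : ∃ H : Matrix n n ℂ, H.IsHermitian ∧ riccatiMap A P H = 0 := by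
  have hc := isCompact_riccatiSet A hP
  obtain ⟨H, hmem, hmin⟩ := hc.exists_isMinOn ⟨0, zero_mem_riccatiSet A P⟩
    (continuous_riccatiMap A P).norm.continuousOn
  obtain ⟨C, hC⟩ := hc.exists_bound_of_continuousOn
    (f := fun X => A - X * P) (by fun_prop)
  refine ⟨H, hmem.1, ?_⟩
  by_contra hne
  have hpos : 0 < ‖riccatiMap A P H‖ := norm_pos_iff.mpr hne
  have hC0 : 0 ≤ C := (norm_nonneg _).trans (hC H hmem)
  set r : ℝ := (2 * C + 1) / ‖riccatiMap A P H‖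
  have hr : 0 < r := by positivity
  obtain ⟨X, hX, hXeq⟩ := exists_mem_riccatiSet_smul_sq_eq A hP r
  set S := riccatiMap A P X with hS
  have hle : ‖riccatiMap A P H‖ ≤ ‖S‖ := hmin hX
  have hSH : Sᴴ = S := hX.2.posSemidef.isHermitian
  have hBH : Aᴴ - P * X = (A - X * P)ᴴ := by simp [hP.isHermitian.eq, hX.1.eq]
  have h1 : r * (‖S‖ * ‖S‖) ≤ 2 * C * ‖S‖ := by
    have e := congrArg norm hXeq
    have e0 := l2_opNorm_conjTranspose_mul_self S
    rw [hSH] at e0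
    rw [norm_smul, e0, norm_neg, Complex.norm_real, Real.norm_of_nonneg hr.le, hBH] at e
    rw [e]
    have e1 := norm_mul_le (A - X * P) S
    have e2 := norm_mul_le S (A - X * P)ᴴ
    rw [l2_opNorm_conjTranspose] at e2
    have e3 := mul_le_mul_of_nonneg_right (hC X hX) (norm_nonneg S)
    have e4 := norm_add_le ((A - X * P) * S) (S * (A - X * P)ᴴ)
    linarith
  have h2 : r * ‖S‖ ≤ 2 * C :=
    le_of_mul_le_mul_right (by linarith) (hpos.trans_le hle)
  have h3 : r * ‖riccatiMap A P H‖ = 2 * C + 1 := div_mul_cancel₀ _ hpos.ne'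
  have h4 := mul_le_mul_of_nonneg_left hle hr.le
  linarith

end Riccati

/-- For `R ∈ M_k(ℂ)`, positive definite `P` and real `γ`, there is a Hermitian `H`
with `I + RH + HR* - HPH = γH`. -/
theorem exists_hermitian_riccati {k : ℕ} (R P : Matrix (Fin k) (Fin k) ℂ)
    (hP : P.PosDef) (γ : ℝ) :
    ∃ H : Matrix (Fin k) (Fin k) ℂ, H.IsHermitian ∧
      1 + R * H + H * Rᴴ - H * P * H = (γ : ℂ) • H := by
  obtain ⟨H, hH, h0⟩ := exists_isHermitian_riccatiMap_eq_zero
    (R - ((γ / 2 : ℝ) : ℂ) • (1 : Matrix (Fin k) (Fin k) ℂ)) hP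
  refine ⟨H, hH, ?_⟩
  rw [← sub_eq_zero, ← h0, riccatiMap]
  have hγ : (γ : ℂ) • H = ((γ / 2 : ℝ) : ℂ) • H + ((γ / 2 : ℝ) : ℂ) • H := by
    rw [← add_smul, ← Complex.ofReal_add, add_halves]
  simp only [hγ, conjTranspose_sub, conjTranspose_smul, conjTranspose_one, Complex.star_def,
    Complex.conj_ofReal, Matrix.sub_mul, Matrix.mul_sub, Matrix.smul_mul, Matrix.mul_smul,
    Matrix.one_mul, Matrix.mul_one]
  abel
end

section
/- Let C, P be k×k complex matrices with P positive definite and C a strict contraction (i.e., the operator norm of C is strictly less than 1). Then there exist a unitary k×k matrix U and a Hermitian k×k matrix H such that C = U + PH. -/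
open Matrix
open scoped ComplexOrder

section

open scoped Matrix.Norms.L2Operator MatrixOrder

variable {n : Type*} [Fintype n] [DecidableEq n]

/-- Every linear functional on square matrices is `X ↦ tr (Z * X)` for some matrix `Z`. -/
lemma Matrix.exists_eq_trace_mul {R : Type*} [CommSemiring R] (f : Matrix n n R →ₗ[R] R) :
    ∃ Z : Matrix n n R, ∀ X, f X = (Z * X).trace := by
  refine ⟨of fun j i ↦ f (single i j 1), fun X ↦ ?_⟩
  conv_lhs => rw [matrix_eq_sum_single X]
  simp only [map_sum, trace, diag_apply, mul_apply, of_apply]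
  rw [Finset.sum_comm]
  refine Finset.sum_congr rfl fun j _ ↦ Finset.sum_congr rfl fun i _ ↦ ?_
  rw [show single i j (X i j) = X i j • single i j (1 : R) by simp [smul_single], map_smul,
    smul_eq_mul, mul_comm]

lemma Matrix.posSemidef_one_sub_mul_conjTranspose {Y : Matrix n n ℂ} (hY : ‖Y‖ ≤ 1) :
    (1 - Y * Yᴴ).PosSemidef := by
  have h : Y * star Y ≤ 1 := by
    rw [← CStarAlgebra.norm_le_one_iff_of_nonneg (Y * star Y) (mul_star_self_nonneg Y),
      CStarRing.norm_self_mul_star]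
    exact mul_le_one₀ hY (norm_nonneg _) hY
  exact le_iff.mp h

lemma Matrix.norm_le_one_of_conjTranspose_mul_self_eq_one {U : Matrix n n ℂ}
    (hU : Uᴴ * U = 1) : ‖U‖ ≤ 1 := by
  have h := l2_opNorm_conjTranspose_mul_self U
  cases subsingleton_or_nontrivial (Matrix n n ℂ) with
  | inl _ => simp [Subsingleton.elim U 0]
  | inr _ =>
    rw [hU, norm_one] at h
    nlinarith [norm_nonneg U]

/-- A contraction `Y` for which `Re tr (T * Y)` is at least `tr T`, with `T` positive definite,
is the identity. -/
lemma Matrix.PosDef.eq_one_of_trace_le_trace_mul {T Y : Matrix n n ℂ} (hT : T.PosDef)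
    (hY : ‖Y‖ ≤ 1) (h : T.trace.re ≤ (T * Y).trace.re) : Y = 1 := by
  have hW : ((1 - Y)ᴴ * T * (1 - Y)).PosSemidef :=
    hT.posSemidef.conjTranspose_mul_mul_same (1 - Y)
  have hR : (CFC.sqrt T)ᴴ = CFC.sqrt T := (CFC.sqrt_nonneg T).posSemidef.isHermitian
  have hRR : CFC.sqrt T * CFC.sqrt T = T := CFC.sqrt_mul_sqrt_self T hT.posSemidef.nonneg
  have hD := ((posSemidef_one_sub_mul_conjTranspose hY).conjTranspose_mul_mul_same
    (CFC.sqrt T)).trace_nonneg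
  rw [hR, trace_mul_comm, ← mul_assoc, hRR, mul_sub, trace_sub, mul_one] at hD
  have hD' := (Complex.le_def.mp hD).1
  have hconj : (Yᴴ * T).trace = star (T * Y).trace := by
    rw [← trace_conjTranspose, conjTranspose_mul, hT.isHermitian.eq]
  have htr : ((1 - Y)ᴴ * T * (1 - Y)).trace =
      T.trace - (T * Y).trace - star (T * Y).trace + (T * (Y * Yᴴ)).trace := by
    rw [← hconj, ← mul_assoc, trace_mul_comm (T * Y), ← trace_sub, ← trace_sub, ← trace_add]
    congr 1
    simp only [conjTranspose_sub, conjTranspose_one]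
    noncomm_ring
  have hpos := Complex.le_def.mp hW.trace_nonneg
  have hzero : ((1 - Y)ᴴ * T * (1 - Y)).trace = 0 := by
    refine Complex.ext (le_antisymm ?_ hpos.1) hpos.2.symm
    rw [htr]
    simp only [Complex.sub_re, Complex.add_re, Complex.zero_re, Complex.star_def,
      Complex.conj_re] at hD' ⊢
    linarith
  have h0 := hW.trace_eq_zero_iff.mp hzero
  have h1 : CFC.sqrt T * (1 - Y) = 0 := by
    rw [← conjTranspose_mul_self_eq_zero, conjTranspose_mul, hR, mul_assoc,
      ← mul_assoc (CFC.sqrt T), hRR, ← mul_assoc, h0]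
  have h2 : T * (1 - Y) = 0 := by rw [← hRR, mul_assoc, h1, mul_zero]
  exact (sub_eq_zero.mp (hT.isUnit.mul_right_eq_zero.mp h2)).symm

/-- A contraction maximizing `Re tr (Z * X)` over the unit ball, with `Z` invertible, is
unitary. -/
lemma Matrix.conjTranspose_mul_self_eq_one_of_isMaxOn {Z V : Matrix n n ℂ} (hZ : IsUnit Z)
    (hV : ‖V‖ ≤ 1) (h : ∀ X : Matrix n n ℂ, ‖X‖ ≤ 1 → (Z * X).trace.re ≤ (Z * V).trace.re) :
    Vᴴ * V = 1 := by
  have hdet := (isUnit_iff_isUnit_det Z).mp hZ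
  have hnn : 0 ≤ Z * Zᴴ := (posSemidef_self_mul_conjTranspose Z).nonneg
  set T := CFC.sqrt (Z * Zᴴ)
  have hTT : T * T = Z * Zᴴ := CFC.sqrt_mul_sqrt_self _ hnn
  have hTps : T.PosSemidef := (CFC.sqrt_nonneg _).posSemidef
  have hTu : IsUnit T := by
    rw [isUnit_iff_isUnit_det]
    have : IsUnit (T * T).det := by
      rw [hTT, det_mul, det_conjTranspose]
      exact hdet.mul hdet.star
    rw [det_mul] at this
    exact isUnit_of_mul_isUnit_left this
  have hT : T.PosDef := hTps.posDef_iff_isUnit.mpr hTu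
  have hU : (Z⁻¹ * T) * (Z⁻¹ * T)ᴴ = 1 := by
    rw [conjTranspose_mul, hTps.isHermitian.eq, mul_assoc, ← mul_assoc T, hTT, mul_assoc Z,
      ← mul_assoc, nonsing_inv_mul _ hdet, one_mul, ← conjTranspose_mul,
      nonsing_inv_mul _ hdet, conjTranspose_one]
  set U := Z⁻¹ * T with hUdef
  have hU' : Uᴴ * U = 1 := mul_eq_one_comm.mp hU
  have hZU : Z * U = T := by rw [hUdef, ← mul_assoc, mul_nonsing_inv _ hdet, one_mul]
  have hU1 := norm_le_one_of_conjTranspose_mul_self_eq_one hU'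
  have hY : ‖Uᴴ * V‖ ≤ 1 := by
    refine (l2_opNorm_mul _ _).trans (mul_le_one₀ ?_ (norm_nonneg _) hV)
    rwa [l2_opNorm_conjTranspose]
  have hUV : Uᴴ * V = 1 := by
    refine hT.eq_one_of_trace_le_trace_mul hY ?_
    have := h U hU1
    rwa [hZU, show Z * V = T * (Uᴴ * V) by rw [← hZU, mul_assoc, ← mul_assoc U, hU, one_mul]]
      at this
  have : V = U := by rw [← one_mul V, ← hU, mul_assoc, hUV, mul_one]
  rw [this, hU']

/-- Among Hermitian `H` with `C - P * H` a contraction, one has maximal trace. -/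
lemma Matrix.exists_isHermitian_isMaxOn_trace {C P : Matrix n n ℂ} (hP : IsUnit P)
    (hC : ‖C‖ < 1) :
    ∃ H : Matrix n n ℂ, H.IsHermitian ∧ ‖C - P * H‖ ≤ 1 ∧
      ∀ H' : Matrix n n ℂ, H'.IsHermitian → ‖C - P * H'‖ ≤ 1 → H'.trace.re ≤ H.trace.re := by
  have hdet := (isUnit_iff_isUnit_det P).mp hP
  let K : Set (Matrix n n ℂ) := {H | H.IsHermitian ∧ ‖C - P * H‖ ≤ 1}
  have hclosed : IsClosed K := by
    have h1 : IsClosed {H : Matrix n n ℂ | Hᴴ = H} := isClosed_eq continuous_star continuous_id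
    have h2 : IsClosed {H : Matrix n n ℂ | ‖C - P * H‖ ≤ 1} :=
      isClosed_le (by fun_prop) continuous_const
    exact h1.inter h2
  have hbdd : Bornology.IsBounded K := by
    refine (Metric.isBounded_closedBall (x := (0 : Matrix n n ℂ)) (r := ‖P⁻¹‖ * 2)).subset ?_
    rintro H ⟨-, hH⟩
    have hHeq : H = P⁻¹ * (C - (C - P * H)) := by
      rw [sub_sub_cancel, ← mul_assoc, nonsing_inv_mul _ hdet, one_mul]
    rw [mem_closedBall_zero_iff, hHeq]
    refine (l2_opNorm_mul _ _).trans (mul_le_mul_of_nonneg_left ?_ (norm_nonneg _))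
    exact (norm_sub_le _ _).trans (by linarith)
  have : ProperSpace (Matrix n n ℂ) := FiniteDimensional.proper ℂ _
  have hcomp : IsCompact K := Metric.isCompact_of_isClosed_isBounded hclosed hbdd
  have hne : K.Nonempty := ⟨0, isHermitian_zero, by simpa using hC.le⟩
  have hcont : Continuous fun H : Matrix n n ℂ ↦ H.trace.re :=
    Complex.continuous_re.comp (continuous_id.matrix_trace)
  obtain ⟨H, hH, hmax⟩ := hcomp.exists_isMaxOn hne hcont.continuousOn
  exact ⟨H, hH.1, hH.2, fun H' h1 h2 ↦ hmax ⟨h1, h2⟩⟩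

lemma Matrix.exists_isHermitian_unitary_sub_mul {C P : Matrix n n ℂ} (hP : IsUnit P)
    (hC : ‖C‖ < 1) :
    ∃ H : Matrix n n ℂ, H.IsHermitian ∧ (C - P * H)ᴴ * (C - P * H) = 1 := by
  cases isEmpty_or_nonempty n with
  | inl _ => exact ⟨0, isHermitian_zero, Subsingleton.elim _ _⟩
  | inr _ =>
  obtain ⟨H, hH, hH1, hmax⟩ := exists_isHermitian_isMaxOn_trace hP hC
  refine ⟨H, hH, ?_⟩
  let S : Set (Matrix n n ℂ) :=
    {Y | ∃ E : Matrix n n ℂ, E.IsHermitian ∧ H.trace.re ≤ E.trace.re ∧ Y = C - P * E}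
  have hS : Convex ℝ S := by
    rintro _ ⟨E, hE, htE, rfl⟩ _ ⟨F, hF, htF, rfl⟩ a b ha hb hab
    refine ⟨a • E + b • F, ?_, ?_, ?_⟩
    · exact (hE.smul (IsSelfAdjoint.all a)).add (hF.smul (IsSelfAdjoint.all b))
    · simp only [trace_add, trace_smul, Complex.add_re, Complex.smul_re, smul_eq_mul]
      calc H.trace.re = a * H.trace.re + b * H.trace.re := by rw [← add_mul, hab, one_mul]
        _ ≤ _ := by gcongr
    · have : C = a • C + b • C := by rw [← add_smul, hab, one_smul]
      rw [mul_add, mul_smul_comm, mul_smul_comm, smul_sub, smul_sub]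
      nth_rewrite 3 [this]
      abel
  have hdisj : Disjoint (Metric.ball (0 : Matrix n n ℂ) 1) S := by
    rw [Set.disjoint_left]
    rintro _ hX ⟨E, hE, htE, rfl⟩
    have hcont : Continuous fun t : ℝ ↦ C - P * (E + t • (1 : Matrix n n ℂ)) := by fun_prop
    have hmem : ∀ᶠ t in nhds (0 : ℝ),
        C - P * (E + t • (1 : Matrix n n ℂ)) ∈ Metric.ball (0 : Matrix n n ℂ) 1 :=
      hcont.continuousAt.eventually_mem (Metric.isOpen_ball.mem_nhds (by simpa using hX))
    obtain ⟨t, ht, ht0⟩ :=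
      ((hmem.filter_mono nhdsWithin_le_nhds).and
        (self_mem_nhdsWithin : Set.Ioi (0 : ℝ) ∈ nhdsWithin 0 (Set.Ioi 0))).exists
    have := hmax _ (hE.add (isHermitian_one.smul (IsSelfAdjoint.all t)))
      (mem_ball_zero_iff.mp ht).le
    simp only [trace_add, trace_smul, trace_one, Complex.add_re, Complex.smul_re, smul_eq_mul,
      Complex.natCast_re] at this
    have hcard : (0 : ℝ) < Fintype.card n := by exact_mod_cast Fintype.card_pos
    have := mul_pos (Set.mem_Ioi.mp ht0) hcard
    linarith
  obtain ⟨f, u, hfB, hfS⟩ := RCLike.geometric_hahn_banach_open (𝕜 := ℂ)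
    (convex_ball (0 : Matrix n n ℂ) 1) Metric.isOpen_ball hS hdisj
  obtain ⟨Z, hZ⟩ := exists_eq_trace_mul (f : Matrix n n ℂ →ₗ[ℂ] ℂ)
  replace hZ : ∀ X, f X = (Z * X).trace := hZ
  simp only [hZ, RCLike.re_eq_complex_re] at hfB hfS
  have hZu : IsUnit Z := by
    rw [isUnit_iff_isUnit_det, isUnit_iff_ne_zero]
    intro hdet
    obtain ⟨v, hv, hvZ⟩ := exists_vecMul_eq_zero_iff.mpr hdet
    have hE : (vecMulVec (star v) v).PosSemidef := posSemidef_vecMulVec_star_self v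
    have hZE : (Z * (P * vecMulVec (star v) v)).trace = 0 := by
      rw [← mul_assoc, trace_mul_comm, ← mul_assoc, vecMulVec_mul, hvZ, vecMulVec_zero, zero_mul,
        trace_zero]
    have htr : 0 < (vecMulVec (star v) v).trace.re := by
      rw [trace_vecMulVec]
      exact (Complex.lt_def.mp (dotProduct_star_self_pos_iff.mpr hv)).1
    set E := vecMulVec (star v) v
    have h1 := hfS (C - P * ((H.trace.re / E.trace.re) • E))
      ⟨_, hE.isHermitian.smul (IsSelfAdjoint.all _), by
        rw [trace_smul, Complex.smul_re, smul_eq_mul, div_mul_cancel₀ _ htr.ne'], rfl⟩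
    have h2 := hfB C (mem_ball_zero_iff.mpr hC)
    rw [mul_sub, trace_sub, mul_smul_comm, mul_smul_comm, trace_smul, hZE, smul_zero,
      sub_zero] at h1
    linarith
  refine conjTranspose_mul_self_eq_one_of_isMaxOn hZu hH1 fun X hX ↦ ?_
  refine le_trans ?_ (hfS _ ⟨H, hH, le_rfl, rfl⟩)
  have hcl : X ∈ closure (Metric.ball (0 : Matrix n n ℂ) 1) := by
    rw [closure_ball _ one_ne_zero]
    exact mem_closedBall_zero_iff.mpr hX
  have hcont : Continuous fun X : Matrix n n ℂ ↦ (Z * X).trace.re :=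
    Complex.continuous_re.comp (continuous_const.mul continuous_id).matrix_trace
  exact closure_minimal (fun Y hY ↦ (hfB Y hY).le) (isClosed_le hcont continuous_const) hcl

end

/-- For a strict contraction `C` (operator norm `< 1`) and positive definite `P`,
we can write `C = U + PH` with `U` unitary and `H` Hermitian. -/
theorem strict_contraction_eq_unitary_add_posDef_mul_hermitian {k : ℕ}
    (C P : Matrix (Fin k) (Fin k) ℂ) (hP : P.PosDef)
    (hC : ‖Matrix.toEuclideanCLM (𝕜 := ℂ) C‖ < 1) :
    ∃ (U H : Matrix (Fin k) (Fin k) ℂ), Uᴴ * U = 1 ∧ H.IsHermitian ∧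
      C = U + P * H := by

  obtain ⟨H, hH, hU⟩ := Matrix.exists_isHermitian_unitary_sub_mul hP.isUnit
    (by rwa [Matrix.cstar_norm_def])
  exact ⟨C - P * H, H, hU, hH, (sub_add_cancel _ _).symm⟩
end

section
/- Let M be a k×k complex matrix and P a positive definite k×k complex matrix. Then there exists a Hermitian k×k matrix H satisfying I_k + MH + HM* − HPH = H. -/
open Matrix
open scoped ComplexOrder

namespace Matrix

variable {n : Type*} [Fintype n]

theorem IsHermitian.ofReal_re_dotProduct_mulVec {X : Matrix n n ℂ} (hX : X.IsHermitian)
    (v : n → ℂ) : ((star v ⬝ᵥ X *ᵥ v).re : ℂ) = star v ⬝ᵥ X *ᵥ v := by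
  have h : star (star v ⬝ᵥ X *ᵥ v) = star v ⬝ᵥ X *ᵥ v := by
    rw [← star_dotProduct, star_mulVec, hX.eq, dotProduct_mulVec]
  exact Complex.conj_eq_iff_re.mp h

theorem IsHermitian.posSemidef_of_re_nonneg {X : Matrix n n ℂ} (hX : X.IsHermitian)
    (h : ∀ v : n → ℂ, 0 ≤ (star v ⬝ᵥ X *ᵥ v).re) : X.PosSemidef := by
  refine .of_dotProduct_mulVec_nonneg hX fun v => ?_
  rw [← hX.ofReal_re_dotProduct_mulVec]
  exact_mod_cast h v

/-- Some real shift of a Hermitian matrix along a positive definite one is positive semidefinite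
and singular. -/
theorem IsHermitian.exists_posSemidef_add_smul_mulVec_eq_zero [Nonempty n] {X H : Matrix n n ℂ}
    (hX : X.IsHermitian) (hH : H.PosDef) :
    ∃ (t : ℝ) (v : n → ℂ), v ≠ 0 ∧ (X + t • H).PosSemidef ∧ (X + t • H) *ᵥ v = 0 := by
  have hpos : ∀ v : n → ℂ, v ≠ 0 → 0 < (star v ⬝ᵥ H *ᵥ v).re := fun v hv => hH.re_dotProduct_pos hv
  have hcont : ∀ Y : Matrix n n ℂ, Continuous fun v : n → ℂ => (star v ⬝ᵥ Y *ᵥ v).re := fun Y =>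
    Complex.continuous_re.comp
      (continuous_star.dotProduct (Continuous.matrix_mulVec continuous_const continuous_id))
  obtain ⟨v, hv, hmin⟩ := (isCompact_sphere (0 : n → ℂ) 1).exists_isMinOn
    (NormedSpace.sphere_nonempty.mpr zero_le_one)
    (f := fun v : n → ℂ => (star v ⬝ᵥ X *ᵥ v).re / (star v ⬝ᵥ H *ᵥ v).re)
    ((hcont X).continuousOn.div (hcont H).continuousOn fun v hv =>
      (hpos v (ne_zero_of_mem_unit_sphere ⟨v, hv⟩)).ne')
  have hv0 : v ≠ 0 := ne_zero_of_mem_unit_sphere ⟨v, hv⟩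
  set r := (star v ⬝ᵥ X *ᵥ v).re / (star v ⬝ᵥ H *ᵥ v).re with hr
  have hre : ∀ w : n → ℂ, (star w ⬝ᵥ (X + (-r) • H) *ᵥ w).re =
      (star w ⬝ᵥ X *ᵥ w).re - r * (star w ⬝ᵥ H *ᵥ w).re := by
    intro w
    simp [add_mulVec, neg_mulVec, smul_mulVec, sub_eq_add_neg]
  have hY : (X + (-r) • H).PosSemidef := by
    refine IsHermitian.posSemidef_of_re_nonneg
      (hX.add (hH.isHermitian.smul (IsSelfAdjoint.all _))) fun w => ?_
    rcases eq_or_ne w 0 with rfl | hw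
    · simp
    have hw' : ‖w‖ ≠ 0 := norm_ne_zero_iff.mpr hw
    have hmem : (‖w‖⁻¹ : ℝ) • w ∈ Metric.sphere (0 : n → ℂ) 1 := by
      simp [norm_smul, hw']
    have hle := isMinOn_iff.mp hmin _ hmem
    have hscale : ∀ Y : Matrix n n ℂ,
        (star ((‖w‖⁻¹ : ℝ) • w) ⬝ᵥ Y *ᵥ ((‖w‖⁻¹ : ℝ) • w)).re =
          (‖w‖⁻¹ * ‖w‖⁻¹) * (star w ⬝ᵥ Y *ᵥ w).re := by
      intro Y
      simp [mulVec_smul, mul_assoc]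
    simp only [hscale] at hle
    rw [mul_div_mul_left _ _ (by positivity), ← hr, le_div_iff₀ (hpos w hw)] at hle
    rw [hre]
    linarith
  refine ⟨-r, v, hv0, hY, (hY.dotProduct_mulVec_zero_iff v).mp ?_⟩
  rw [← hY.isHermitian.ofReal_re_dotProduct_mulVec, hre, hr,
    div_mul_cancel₀ _ (hpos v hv0).ne', sub_self, Complex.ofReal_zero]

theorem IsHermitian.dotProduct_lyapunov_mulVec_eq_zero {Y : Matrix n n ℂ} (hY : Y.IsHermitian)
    (A : Matrix n n ℂ) {v : n → ℂ} (hv : Y *ᵥ v = 0) :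
    star v ⬝ᵥ (A * Y + Y * Aᴴ) *ᵥ v = 0 := by
  have h : star v ᵥ* Y = 0 := by
    rw [← hY.eq, ← star_mulVec, hv, star_zero]
  rw [add_mulVec, ← mulVec_mulVec, ← mulVec_mulVec, hv, dotProduct_add, dotProduct_mulVec _ Y, h]
  simp

theorem PosSemidef.posDef_of_lyapunov {A H : Matrix n n ℂ} (hH : H.PosSemidef)
    (hAH : (-(A * H + H * Aᴴ)).PosDef) : H.PosDef := by
  refine .of_dotProduct_mulVec_pos hH.isHermitian fun v hv =>
    (hH.dotProduct_mulVec_nonneg v).lt_of_ne' fun h0 => ?_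
  have h := hAH.dotProduct_mulVec_pos hv
  rw [neg_mulVec, dotProduct_neg, hH.isHermitian.dotProduct_lyapunov_mulVec_eq_zero A
    ((hH.dotProduct_mulVec_zero_iff v).mp h0)] at h
  simp at h

/-- If `H` certifies the stability of `A`, then Hermitian solutions of the Lyapunov inequality
`A X + X Aᴴ ≤ 0` are positive semidefinite. -/
theorem PosDef.posSemidef_of_lyapunov_s16 {A H X : Matrix n n ℂ} (hH : H.PosDef)
    (hAH : (-(A * H + H * Aᴴ)).PosDef) (hX : X.IsHermitian)
    (hAX : (-(A * X + X * Aᴴ)).PosSemidef) : X.PosSemidef := by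
  rcases isEmpty_or_nonempty n with hn | hn
  · rw [Subsingleton.elim X 0]
    exact .zero
  obtain ⟨t, v, hv, hY, hYv⟩ := hX.exists_posSemidef_add_smul_mulVec_eq_zero hH
  have h0 := hY.isHermitian.dotProduct_lyapunov_mulVec_eq_zero A hYv
  have ht : t ≤ 0 := by
    by_contra! ht
    have hsum : A * (X + t • H) + (X + t • H) * Aᴴ =
        -(-(A * X + X * Aᴴ) + t • (-(A * H + H * Aᴴ))) := by
      simp only [mul_add, add_mul, mul_smul_comm, smul_mul_assoc]
      module
    have h := (PosDef.posSemidef_add hAX (hAH.smul ht)).dotProduct_mulVec_pos hv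
    rw [hsum, neg_mulVec, dotProduct_neg, neg_eq_zero] at h0
    exact h.ne' h0
  have h := hY.add (hH.posSemidef.smul (neg_nonneg.mpr ht))
  rwa [show X + t • H + (-t) • H = X by module] at h

theorem PosDef.exists_lyapunov_eq {A H W : Matrix n n ℂ} (hH : H.PosDef)
    (hAH : (-(A * H + H * Aᴴ)).PosDef) (hW : W.IsHermitian) :
    ∃ X : Matrix n n ℂ, X.IsHermitian ∧ A * X + X * Aᴴ = W := by
  let V := selfAdjoint.submodule ℝ (Matrix n n ℂ)
  let L : V →ₗ[ℝ] V :=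
    { toFun := fun X => ⟨A * X.1 + X.1 * Aᴴ, by
        have hX : (X : Matrix n n ℂ)ᴴ = X := X.2
        change (A * X.1 + X.1 * Aᴴ)ᴴ = A * X.1 + X.1 * Aᴴ
        simp [conjTranspose_mul, hX, add_comm]⟩
      map_add' := fun X Y => Subtype.ext <| by
        simp only [Submodule.coe_add, mul_add, add_mul]
        abel
      map_smul' := fun c X => Subtype.ext <| by
        simp }
  have hinj : Function.Injective L := by
    rw [injective_iff_map_eq_zero]
    intro X hX
    have hX' : A * X.1 + X.1 * Aᴴ = 0 := congrArg Subtype.val hX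
    have hXh : (X : Matrix n n ℂ).IsHermitian := X.2
    have h1 := hH.posSemidef_of_lyapunov_s16 hAH hXh (by rw [hX', neg_zero]; exact .zero)
    have h2 := hH.posSemidef_of_lyapunov_s16 hAH hXh.neg (by
      rw [mul_neg, neg_mul, ← neg_add, hX', neg_zero, neg_zero]; exact .zero)
    refine Subtype.ext (h1.trace_eq_zero_iff.mp (le_antisymm ?_ h1.trace_nonneg))
    simpa using h2.trace_nonneg
  obtain ⟨X, hX⟩ := LinearMap.injective_iff_surjective.mp hinj ⟨W, hW⟩
  exact ⟨X, X.2, congrArg Subtype.val hX⟩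

theorem isClosed_setOf_posSemidef : IsClosed {X : Matrix n n ℂ | X.PosSemidef} := by
  simp only [posSemidef_iff_dotProduct_mulVec, Set.ofPred_and, Set.ofPred_forall]
  refine (isClosed_eq continuous_id.matrix_conjTranspose continuous_id).inter
    (isClosed_iInter fun v => ?_)
  exact isClosed_le continuous_const
    (continuous_const.dotProduct (continuous_id.matrix_mulVec continuous_const))

section

open scoped MatrixOrder Matrix.Norms.L2Operator

theorem PosSemidef.exists_eq_conjTranspose_mul_self {X : Matrix n n ℂ} (hX : X.PosSemidef) :
    ∃ B : Matrix n n ℂ, X = Bᴴ * B := by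
  classical
  exact CStarAlgebra.nonneg_iff_eq_star_mul_self.mp hX.nonneg

end

section

attribute [local instance] Matrix.frobeniusNormedAddCommGroup Matrix.frobeniusNormedSpace

theorem exists_forall_trace_re_le {s : Set (Matrix n n ℂ)} (hs : IsClosed s) (hne : s.Nonempty)
    (hpsd : ∀ X ∈ s, X.PosSemidef) : ∃ X ∈ s, ∀ Y ∈ s, X.trace.re ≤ Y.trace.re := by
  classical
  have hfac : ∀ X ∈ s, ∃ B : Matrix n n ℂ, X = Bᴴ * B := fun X hX =>
    (hpsd X hX).exists_eq_conjTranspose_mul_self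
  have htr : ∀ B : Matrix n n ℂ, (Bᴴ * B).trace.re = ‖B‖ ^ 2 := by
    intro B
    rw [frobenius_norm_def, ← Real.sqrt_eq_rpow, Real.sq_sqrt (by positivity), Finset.sum_comm]
    simp [trace, mul_apply, Complex.sq_norm, Complex.normSq_apply]
  have : ProperSpace (Matrix n n ℂ) := FiniteDimensional.proper ℂ _
  have hclosed : IsClosed ((fun B : Matrix n n ℂ => Bᴴ * B) ⁻¹' s) :=
    hs.preimage (continuous_id.matrix_conjTranspose.matrix_mul continuous_id)
  obtain ⟨B, hB, hmin⟩ := hclosed.exists_infDist_eq_dist (by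
    obtain ⟨X, hX⟩ := hne
    obtain ⟨B, rfl⟩ := hfac X hX
    exact ⟨B, hX⟩) 0
  refine ⟨Bᴴ * B, hB, fun Y hY => ?_⟩
  obtain ⟨C, rfl⟩ := hfac Y hY
  rw [htr, htr]
  have h := Metric.infDist_le_dist_of_mem (x := (0 : Matrix n n ℂ))
    (show C ∈ (fun B : Matrix n n ℂ => Bᴴ * B) ⁻¹' s from hY)
  rw [hmin, dist_zero_left, dist_zero_left] at h
  gcongr

end

/-- A large multiple of the identity satisfies the Riccati inequality. -/
theorem PosDef.exists_posSemidef_riccati_nonpos [DecidableEq n] {P : Matrix n n ℂ} (hP : P.PosDef)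
    (M : Matrix n n ℂ) : ∃ H : Matrix n n ℂ, H.PosSemidef ∧
      (-(1 + M * H + H * Mᴴ - H * P * H - H)).PosSemidef := by
  rcases isEmpty_or_nonempty n with hn | hn
  · exact ⟨0, .zero, by rw [Subsingleton.elim (-_) (0 : Matrix n n ℂ)]; exact .zero⟩
  obtain ⟨t, -, -, ht, -⟩ := IsHermitian.exists_posSemidef_add_smul_mulVec_eq_zero
    (X := -(M + Mᴴ) - 1) ((isHermitian_add_transpose_self M).neg.sub isHermitian_one) hP
  have hc : 0 ≤ |t| := abs_nonneg t
  refine ⟨(1 + |t|) • 1, PosSemidef.one.smul (by positivity), ?_⟩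
  have h := ((ht.smul (show 0 ≤ 1 + |t| by positivity)).add (hP.posSemidef.smul
    (show 0 ≤ (1 + |t|) * (1 + |t| - t) from
      mul_nonneg (by positivity) (by linarith [le_abs_self t])))).add
    ((PosSemidef.one (n := n) (R := ℂ)).smul (show 0 ≤ 2 * (1 + |t|) - 1 by linarith))
  convert h using 1
  simp only [mul_smul_comm, smul_mul_assoc, mul_one, one_mul]
  module

end Matrix

/-- For `M ∈ M_k(ℂ)` and positive definite `P`, there is a Hermitian `H` with
`I + MH + HM* - HPH = H`. -/
theorem exists_hermitian_solution {k : ℕ} (M P : Matrix (Fin k) (Fin k) ℂ)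
    (hP : P.PosDef) :
    ∃ H : Matrix (Fin k) (Fin k) ℂ, H.IsHermitian ∧
      1 + M * H + H * Mᴴ - H * P * H = H := by
  let R : Matrix (Fin k) (Fin k) ℂ → Matrix (Fin k) (Fin k) ℂ :=
    fun H => 1 + M * H + H * Mᴴ - H * P * H - H
  have hR : Continuous R := by fun_prop
  obtain ⟨H, ⟨hH, hRH⟩, hmin⟩ := exists_forall_trace_re_le
    (isClosed_setOf_posSemidef.inter (isClosed_setOf_posSemidef.preimage hR.neg))
    (hP.exists_posSemidef_riccati_nonpos M) fun X hX => hX.1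
  simp only [Set.mem_ofPred_eq, Set.mem_preimage, Set.mem_inter_iff, Pi.neg_apply] at hH hRH hmin
  obtain ⟨F, hF⟩ : ∃ F, F = M - (1 / 2 : ℝ) • (1 : Matrix (Fin k) (Fin k) ℂ) - H * P := ⟨_, rfl⟩
  have hFs : Fᴴ = Mᴴ - (1 / 2 : ℝ) • (1 : Matrix (Fin k) (Fin k) ℂ) - P * H := by
    simp [hF, hH.isHermitian.eq, hP.isHermitian.eq]
  have hHPH : (H * P * H).PosSemidef := by
    simpa [hH.isHermitian.eq] using hP.posSemidef.mul_mul_conjTranspose_same H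
  have hFH : F * H + H * Fᴴ = R H - (1 + H * P * H) := by
    rw [hFs, hF]
    simp only [R, sub_mul, mul_sub, mul_smul_comm, smul_mul_assoc, mul_one, one_mul,
      ← mul_assoc]
    module
  have hstable : (-(F * H + H * Fᴴ)).PosDef := by
    rw [hFH, neg_sub, sub_eq_add_neg]
    exact (PosDef.one.add_posSemidef hHPH).add_posSemidef hRH
  have hHpos := hH.posDef_of_lyapunov hstable
  obtain ⟨D, hD, hFD⟩ := hHpos.exists_lyapunov_eq hstable hRH.isHermitian
  have hDneg : (-D).PosSemidef := hHpos.posSemidef_of_lyapunov_s16 hstable hD.neg (by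
    rwa [mul_neg, neg_mul, ← neg_add, hFD, neg_neg])
  have hHD : (H + D).PosSemidef :=
    hHpos.posSemidef_of_lyapunov_s16 hstable (hH.isHermitian.add hD) (by
      rw [show F * (H + D) + (H + D) * Fᴴ = -(1 + H * P * H) by
        rw [mul_add, add_mul, add_add_add_comm, hFH, hFD]; abel, neg_neg]
      exact PosSemidef.one.add hHPH)
  have hRD : R (H + D) = -(D * P * D) := by
    have h : R (H + D) = R H + (F * D + D * Fᴴ) - D * P * D := by
      rw [hFs, hF]
      simp only [R, sub_mul, mul_sub, add_mul, mul_add, mul_smul_comm, smul_mul_assoc,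
        mul_one, one_mul, ← mul_assoc]
      module
    rw [h, hFD]
    abel
  have hle := hmin (H + D) ⟨hHD, by
    rw [hRD, neg_neg]
    simpa [hD.eq] using hP.posSemidef.mul_mul_conjTranspose_same D⟩
  have hD0 : -D = 0 := by
    refine hDneg.trace_eq_zero_iff.mp (le_antisymm ?_ hDneg.trace_nonneg)
    rw [Complex.le_def]
    refine ⟨?_, (Complex.le_def.mp hDneg.trace_nonneg).2.symm⟩
    simp only [trace_add, trace_neg, Complex.add_re, Complex.neg_re, Complex.zero_re] at hle ⊢
    linarith
  have hRH0 : R H = 0 := by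
    rw [neg_eq_zero.mp hD0] at hFD
    simpa using hFD.symm
  exact ⟨H, hH.isHermitian, sub_eq_zero.mp hRH0⟩
end

section
/- Let B be an invertible normal n×n complex matrix such that no two eigenvalues of B have arguments θ and θ + π (i.e., no eigenvalue is a positive real multiple of the negative of another eigenvalue's direction), and suppose that for every ξ ∈ [0, 2π) the Hermitian matrix e^{iξ}B + e^{-iξ}B* has at least k nonnegative eigenvalues (counted with multiplicity). Then there exists an invertible matrix S ∈ M_n(ℂ) such that S*BS has the k×k zero matrix as its leading principal k×k submatrix. -/
open Matrix

/-- The number of nonnegative eigenvalues (counted with multiplicity) of a Hermitian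
matrix `H`; junk value `0` if `H` is not Hermitian. -/
noncomputable def numNonnegEig {n : ℕ} (H : Matrix (Fin n) (Fin n) ℂ) : ℕ :=
  if hH : H.IsHermitian then (Finset.univ.filter fun i => 0 ≤ hH.eigenvalues i).card else 0

lemma prod_sub_mul_prod_succAbove_pos {K : ℕ} {α : Fin (K + 1) → ℝ} {β : Fin K → ℝ}
    (hα : StrictMono α) (h₁ : ∀ j, α j.castSucc < β j) (h₂ : ∀ j, β j < α j.succ)
    (i : Fin (K + 1)) :
    0 < (∏ j, (α i - β j)) * ∏ j, (α i - α (i.succAbove j)) := by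
  rw [← Finset.prod_mul_distrib]
  refine Finset.prod_pos fun j _ => ?_
  rcases lt_or_ge j.castSucc i with hji | hij
  · rw [Fin.succAbove_of_castSucc_lt _ _ hji]
    have h : α j.succ ≤ α i := hα.monotone (Fin.castSucc_lt_iff_succ_le.mp hji)
    have := h₂ j
    have := h₁ j
    exact mul_pos (by linarith) (by linarith)
  · rw [Fin.succAbove_of_le_castSucc _ _ hij]
    have h : α i ≤ α j.castSucc := hα.monotone hij
    have := h₂ j
    have := h₁ j
    exact mul_pos_of_neg_of_neg (by linarith) (by linarith)

lemma sum_eval_div_prod_sub_eq_zero {K : ℕ} {α : Fin (K + 1) → ℝ} (hα : Function.Injective α)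
    {P : Polynomial ℝ} (hP : P.degree < K) :
    ∑ i, P.eval (α i) / ∏ j, (α i - α (i.succAbove j)) = 0 := by
  have h := Lagrange.coeff_eq_sum (s := Finset.univ) hα.injOn (P := P)
    (hP.trans (by simpa using (by exact_mod_cast Nat.lt_succ_self K)))
  rw [Polynomial.coeff_eq_zero_of_degree_lt (by simpa using hP)] at h
  rw [h]
  refine Finset.sum_congr rfl fun i _ => ?_
  congr 1
  have : Finset.univ.erase i = Finset.univ.map i.succAboveEmb := by
    ext x
    simp [Fin.exists_succAbove_eq_iff]
  rw [this, Finset.prod_map]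
  rfl

/-- **Inverse interlacing in codimension one**. -/
lemma exists_compression_of_interlacing {K : ℕ} {α : Fin (K + 1) → ℝ} {β : Fin K → ℝ}
    (h₁ : ∀ j, α j.castSucc < β j) (h₂ : ∀ j, β j < α j.succ) :
    ∃ X : Matrix (Fin (K + 1)) (Fin K) ℝ,
      Xᵀ * X = 1 ∧ Xᵀ * diagonal α * X = diagonal β := by
  have hα : StrictMono α := Fin.strictMono_iff_lt_succ.mpr fun j => (h₁ j).trans (h₂ j)
  have hβ (i : Fin (K + 1)) (j : Fin K) : α i - β j ≠ 0 := by
    have := prod_sub_mul_prod_succAbove_pos hα h₁ h₂ i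
    exact Finset.prod_ne_zero_iff.mp (left_ne_zero_of_mul this.ne') j (Finset.mem_univ j)
  set w : Fin (K + 1) → ℝ :=
    fun i => ((∏ j, (α i - β j)) * ∏ j, (α i - α (i.succAbove j)))⁻¹ with hw_def
  have hw (i) : 0 < w i := inv_pos.mpr (prod_sub_mul_prod_succAbove_pos hα h₁ h₂ i)
  set g : Fin K → Fin (K + 1) → ℝ := fun j i => (∏ l, (α i - β l)) / (α i - β j) with hg_def
  have hg (j i) : g j i ≠ 0 := div_ne_zero
    (Finset.prod_ne_zero_iff.mpr fun l _ => hβ i l) (hβ i j)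
  have hdeg (s : Finset (Fin K)) : (∏ l ∈ s, (Polynomial.X - Polynomial.C (β l))).degree =
      ((s.card : ℕ) : WithBot ℕ) := by
    simp [Polynomial.degree_prod]
  have hprod (i) (j) : ∏ l ∈ Finset.univ.erase j, (α i - β l)
      = (∏ l, (α i - β l)) / (α i - β j) := by
    rw [← Finset.mul_prod_erase _ _ (Finset.mem_univ j), mul_div_cancel_left₀ _ (hβ i j)]
  have hD (i) : ∏ j, (α i - α (i.succAbove j)) ≠ 0 :=
    right_ne_zero_of_mul (prod_sub_mul_prod_succAbove_pos hα h₁ h₂ i).ne'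
  have hB (i) : ∏ l, (α i - β l) ≠ 0 :=
    left_ne_zero_of_mul (prod_sub_mul_prod_succAbove_pos hα h₁ h₂ i).ne'
  have hself (j) : ∑ i, w i * (α i - β j) * (g j i * g j i) = 0 := by
    rw [← sum_eval_div_prod_sub_eq_zero hα.injective
      (P := ∏ l ∈ Finset.univ.erase j, (Polynomial.X - Polynomial.C (β l)))]
    · refine Finset.sum_congr rfl fun i _ => ?_
      have := hβ i j
      have := hD i
      have := hB i
      simp only [Polynomial.eval_prod, Polynomial.eval_sub, Polynomial.eval_X, Polynomial.eval_C,
        hprod, hw_def, hg_def]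
      field_simp
    · rw [hdeg]
      have := j.pos
      simpa using this
  have hoff (j j') (hjj : j ≠ j') (c : ℝ) : ∑ i, w i * (α i - c) * (g j i * g j' i) = 0 := by
    rw [← sum_eval_div_prod_sub_eq_zero hα.injective
      (P := (Polynomial.X - Polynomial.C c) *
        ∏ l ∈ (Finset.univ.erase j).erase j', (Polynomial.X - Polynomial.C (β l)))]
    · refine Finset.sum_congr rfl fun i _ => ?_
      have h1 := hβ i j
      have h2 := hβ i j'
      have := hD i
      have := hB i
      have hp : ∏ l ∈ (Finset.univ.erase j).erase j', (α i - β l)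
          = (∏ l, (α i - β l)) / (α i - β j) / (α i - β j') := by
        rw [← hprod, ← Finset.mul_prod_erase _ _
          (Finset.mem_erase.mpr ⟨hjj.symm, Finset.mem_univ j'⟩),
          mul_div_cancel_left₀ _ h2]
      simp only [Polynomial.eval_prod, Polynomial.eval_sub, Polynomial.eval_X, Polynomial.eval_C,
        Polynomial.eval_mul, hp, hw_def, hg_def]
      field_simp
    · rw [Polynomial.degree_mul, hdeg, Polynomial.degree_X_sub_C,
        Finset.card_erase_of_mem (Finset.mem_erase.mpr ⟨hjj.symm, Finset.mem_univ j'⟩),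
        Finset.card_erase_of_mem (Finset.mem_univ j), Finset.card_univ, Fintype.card_fin]
      have h3 : (j : ℕ) ≠ j' := fun h => hjj (Fin.ext h)
      have h4 := j.isLt
      have h5 := j'.isLt
      exact_mod_cast (by omega : 1 + (K - 1 - 1) < K)
  have horth (j j') (hjj : j ≠ j') : ∑ i, w i * (g j i * g j' i) = 0 := by
    have h := congrArg₂ (· - ·) (hoff j j' hjj 0) (hoff j j' hjj 1)
    simp only [← Finset.sum_sub_distrib] at h
    rw [sub_zero] at h
    rw [← h]
    exact Finset.sum_congr rfl fun i _ => by ring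
  set nrm : Fin K → ℝ := fun j => ∑ i, w i * (g j i * g j i) with hnrm_def
  have hnrm (j) : 0 < nrm j :=
    Finset.sum_pos (fun i _ => mul_pos (hw i) (mul_self_pos.mpr (hg j i))) Finset.univ_nonempty
  have hX (c : Fin (K + 1) → ℝ) (j j') :
      ∑ i, √(w i) * g j i / √(nrm j) * c i * (√(w i) * g j' i / √(nrm j'))
        = (∑ i, w i * c i * (g j i * g j' i)) / (√(nrm j) * √(nrm j')) := by
    rw [Finset.sum_div]
    refine Finset.sum_congr rfl fun i _ => ?_
    nth_rewrite 3 [← Real.mul_self_sqrt (hw i).le]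
    ring
  refine ⟨of fun i j => √(w i) * g j i / √(nrm j), ?_, ?_⟩
  · ext j j'
    have h := hX 1 j j'
    simp only [Pi.one_apply, mul_one] at h
    simp only [mul_apply, transpose_apply, of_apply, h]
    rcases eq_or_ne j j' with rfl | hjj
    · rw [Real.mul_self_sqrt (hnrm j).le, one_apply_eq]
      exact div_self (hnrm j).ne'
    · rw [horth j j' hjj, zero_div, one_apply_ne hjj]
  · ext j j'
    rw [mul_apply]
    simp only [mul_diagonal, transpose_apply, of_apply, hX α j j']
    rcases eq_or_ne j j' with rfl | hjj
    · rw [Real.mul_self_sqrt (hnrm j).le, diagonal_apply_eq, div_eq_iff (hnrm j).ne', ← sub_eq_zero,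
        ← hself j, hnrm_def, Finset.mul_sum, ← Finset.sum_sub_distrib]
      exact Finset.sum_congr rfl fun i _ => by ring
    · have := hoff j j' hjj 0
      simp only [sub_zero] at this
      rw [this, zero_div, diagonal_apply_ne _ hjj]

/-- Restricting a diagonal matrix to the coordinates in the range of `ψ`. -/
lemma submatrix_one_transpose_mul_diagonal_mul {R ι κ : Type*} [CommSemiring R] [Fintype ι]
    [DecidableEq ι] [DecidableEq κ] {ψ : κ → ι} (hψ : Function.Injective ψ) (a : ι → R) :
    ((1 : Matrix ι ι R).submatrix id ψ)ᵀ * diagonal a * (1 : Matrix ι ι R).submatrix id ψ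
      = diagonal (a ∘ ψ) := by
  ext p q
  rw [mul_apply]
  simp +contextual [mul_diagonal, one_apply, diagonal_apply, hψ.eq_iff]

/-- **Inverse interlacing** (Fan–Pall), for strict inequalities. -/
lemma exists_compression_of_interlacing_add {N d : ℕ} {a : Fin (N + d) → ℝ} {b : Fin N → ℝ}
    (h₁ : ∀ j : Fin N, a (j.castAdd d) < b j) (h₂ : ∀ j : Fin N, b j < a (j.addNat d)) :
    ∃ X : Matrix (Fin (N + d)) (Fin N) ℝ,
      Xᵀ * X = 1 ∧ Xᵀ * diagonal a * X = diagonal b := by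
  rcases Nat.eq_zero_or_pos d with rfl | hd
  · have hN : IsEmpty (Fin N) := ⟨fun j => lt_irrefl _ ((h₁ j).trans (h₂ j))⟩
    exact ⟨0, Subsingleton.elim _ _, Subsingleton.elim _ _⟩
  -- the interlacing sequences split into chains along the residue classes modulo `d`
  set K : Fin d → ℕ := fun r => (N + d - 1 - r) / d with hK
  have hKlt (r : Fin d) (m : ℕ) : m < K r ↔ (r : ℕ) + m * d < N := by
    rw [hK, Nat.lt_iff_add_one_le, Nat.le_div_iff_mul_le hd, add_mul, one_mul]
    have := r.isLt
    omega
  have hmod (r : Fin d) (m : ℕ) : ((r : ℕ) + m * d) % d = r := by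
    rw [Nat.add_mul_mod_self_right, Nat.mod_eq_of_lt r.isLt]
  have hinj (r r' : Fin d) (m m' : ℕ) (h : (r : ℕ) + m * d = r' + m' * d) : r = r' ∧ m = m' := by
    have hr : (r : ℕ) = r' := by rw [← hmod r m, h, hmod]
    exact ⟨Fin.ext hr, Nat.eq_of_mul_eq_mul_right hd (by omega)⟩
  have hψlt (p : Σ r : Fin d, Fin (K r + 1)) : (p.1 : ℕ) + p.2 * d < N + d := by
    obtain ⟨r, m, hm⟩ := p
    rcases Nat.eq_zero_or_pos m with rfl | hpos
    · have := r.isLt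
      simp only [zero_mul]
      omega
    · obtain ⟨m, rfl⟩ := Nat.exists_eq_succ_of_ne_zero hpos.ne'
      have := (hKlt r m).mp (by omega)
      simp only [Nat.succ_eq_add_one, add_mul, one_mul]
      omega
  set ψ : (Σ r : Fin d, Fin (K r + 1)) → Fin (N + d) := fun p => ⟨p.1 + p.2 * d, hψlt p⟩ with hψ
  have hψinj : Function.Injective ψ := by
    rintro ⟨r, m⟩ ⟨r', m'⟩ h
    obtain ⟨rfl, hm⟩ := hinj r r' m m' (Fin.ext_iff.mp h)
    rw [Fin.ext hm]
  set φ : (Σ r : Fin d, Fin (K r)) → Fin N :=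
    fun p => ⟨p.1 + p.2 * d, (hKlt p.1 p.2).mp p.2.isLt⟩ with hφ
  have hφbij : Function.Bijective φ := by
    constructor
    · rintro ⟨r, m⟩ ⟨r', m'⟩ h
      obtain ⟨rfl, hm⟩ := hinj r r' m m' (Fin.ext_iff.mp h)
      rw [Fin.ext hm]
    · intro j
      have hj : (j : ℕ) % d + (j / d : ℕ) * d = j := Nat.mod_add_div' _ _
      refine ⟨⟨⟨j % d, Nat.mod_lt _ hd⟩, ⟨j / d, (hKlt _ _).mpr ?_⟩⟩, Fin.ext hj⟩
      exact hj.trans_lt j.isLt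
  choose X hX hXa using fun r : Fin d => exists_compression_of_interlacing
    (α := fun m => a (ψ ⟨r, m⟩)) (β := fun m => b (φ ⟨r, m⟩)) (fun m => h₁ (φ ⟨r, m⟩))
    (fun m => (h₂ (φ ⟨r, m⟩)).trans_eq <| congrArg a <| Fin.ext <| by
      simp only [hφ, hψ, Fin.val_addNat, Fin.val_succ, add_mul, one_mul, add_assoc])
  set e := Equiv.ofBijective φ hφbij
  set E := (1 : Matrix (Fin (N + d)) (Fin (N + d)) ℝ).submatrix id ψ with hE
  set Y := blockDiagonal' X with hY
  have hform (c : Fin (N + d) → ℝ) : (E * Y)ᵀ * diagonal c * (E * Y)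
      = blockDiagonal' fun r => (X r)ᵀ * diagonal (fun m => c (ψ ⟨r, m⟩)) * X r := by
    rw [transpose_mul, blockDiagonal'_mul, blockDiagonal'_mul, blockDiagonal'_diagonal,
      ← blockDiagonal'_transpose, ← hY]
    have := submatrix_one_transpose_mul_diagonal_mul hψinj c
    simp only [← hE] at this
    calc Yᵀ * Eᵀ * diagonal c * (E * Y) = Yᵀ * (Eᵀ * diagonal c * E) * Y := by
          simp only [Matrix.mul_assoc]
      _ = _ := by rw [this]; rfl
  refine ⟨(E * Y).submatrix id e.symm, ?_, ?_⟩
  · have h := hform 1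
    have h1 : diagonal (1 : Fin (N + d) → ℝ) = 1 := diagonal_one
    have h2 (r : Fin d) :
        diagonal (fun m : Fin (K r + 1) => (1 : Fin (N + d) → ℝ) (ψ ⟨r, m⟩)) = 1 :=
      diagonal_one
    simp only [h1, h2, Matrix.mul_one, hX] at h
    change ((E * Y)ᵀ * (E * Y)).submatrix e.symm e.symm = 1
    rw [h, show (blockDiagonal' fun r : Fin d => (1 : Matrix (Fin (K r)) (Fin (K r)) ℝ)) = 1 from
      blockDiagonal'_one, submatrix_one_equiv]
  · have h := hform a
    simp only [hXa] at h
    change ((E * Y)ᵀ * diagonal a * (E * Y)).submatrix e.symm e.symm = _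
    rw [h, blockDiagonal'_diagonal, submatrix_diagonal_equiv]
    congr 1
    ext j
    exact congrArg b (e.apply_symm_apply j)

/-- Orthonormal columns spanning a totally isotropic subspace for `M` extend to a unitary matrix. -/
lemma exists_zero_leading_block_of_isotropic {n k N : ℕ} (hkN : k ≤ N)
    (M : Matrix (Fin n) (Fin n) ℂ) (Y : Matrix (Fin n) (Fin N) ℂ) (hY : Yᴴ * Y = 1)
    (hM : Yᴴ * M * Y = 0) :
    ∃ S : Matrix (Fin n) (Fin n) ℂ, IsUnit S ∧
      ∀ i j : Fin n, (i : ℕ) < k → (j : ℕ) < k → (Sᴴ * M * S) i j = 0 := by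
  set v : Fin n → EuclideanSpace ℂ (Fin n) := fun i =>
    if h : (i : ℕ) < k then WithLp.toLp 2 (fun l => Y l ⟨i, h.trans_le hkN⟩) else 0 with hv
  have horth : Orthonormal ℂ ({i : Fin n | (i : ℕ) < k}.domRestrict v) := by
    rw [orthonormal_iff_ite]
    rintro ⟨i, hi⟩ ⟨j, hj⟩
    simp only [Set.mem_ofPred_eq] at hi hj
    have h := congrFun (congrFun hY ⟨i, hi.trans_le hkN⟩) ⟨j, hj.trans_le hkN⟩
    simp only [mul_apply, conjTranspose_apply, one_apply, Fin.mk.injEq] at h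
    simp only [Set.domRestrict_apply, hv, hi, hj, dif_pos, PiLp.inner_apply, RCLike.inner_apply,
      Subtype.mk.injEq, Fin.ext_iff]
    rw [← h]
    exact Finset.sum_congr rfl fun l _ => mul_comm _ _
  obtain ⟨b, hb⟩ := horth.exists_orthonormalBasis_extension_of_card_eq (by simp)
  set S : Matrix (Fin n) (Fin n) ℂ := of fun l i => b i l with hS
  refine ⟨S, ?_, fun i j hi hj => ?_⟩
  · refine IsUnit.of_mul_eq_one_right Sᴴ ?_
    ext i j
    have h := orthonormal_iff_ite.mp b.orthonormal i j
    simp only [PiLp.inner_apply, RCLike.inner_apply] at h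
    rw [mul_apply, one_apply, ← h]
    exact Finset.sum_congr rfl fun l _ => mul_comm _ _
  · have hcol (i : Fin n) (hi : (i : ℕ) < k) (l) : S l i = Y l ⟨i, hi.trans_le hkN⟩ := by
      simp [hS, hb i hi, hv, hi]
    have h := congrFun (congrFun hM ⟨i, hi.trans_le hkN⟩) ⟨j, hj.trans_le hkN⟩
    simp only [mul_apply, conjTranspose_apply, Matrix.zero_apply] at h ⊢
    simp only [hcol i hi, hcol j hj]
    exact h

/-- Commuting symmetric operators have a common orthonormal eigenbasis. -/
lemma exists_orthonormalBasis_of_commute {E : Type*} [NormedAddCommGroup E]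
    [InnerProductSpace ℂ E] [FiniteDimensional ℂ E] {n : ℕ} (hn : Module.finrank ℂ E = n)
    {T T' : E →ₗ[ℂ] E} (hT : T.IsSymmetric) (hT' : T'.IsSymmetric) (h : Commute T T') :
    ∃ (b : OrthonormalBasis (Fin n) ℂ E) (x y : Fin n → ℂ),
      ∀ i, T (b i) = x i • b i ∧ T' (b i) = y i • b i := by
  classical
  have hint₀ := hT.directSum_isInternal_of_commute hT' h
  have : Finite {i : ℂ × ℂ //
      (Module.End.eigenspace T i.2 ⊓ Module.End.eigenspace T' i.1 : Submodule ℂ E) ≠ ⊥} :=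
    (WellFoundedGT.finite_ne_bot_of_iSupIndep hint₀.submodule_iSupIndep).to_subtype
  have := Fintype.ofFinite {i : ℂ × ℂ //
    (Module.End.eigenspace T i.2 ⊓ Module.End.eigenspace T' i.1 : Submodule ℂ E) ≠ ⊥}
  have hint := DirectSum.isInternal_ne_bot_iff.mpr hint₀
  have hfam := (hT.orthogonalFamily_eigenspace_inf_eigenspace hT').comp
    (Subtype.val_injective (p := fun i : ℂ × ℂ =>
      (Module.End.eigenspace T i.2 ⊓ Module.End.eigenspace T' i.1 : Submodule ℂ E) ≠ ⊥))
  refine ⟨hint.subordinateOrthonormalBasis hn hfam,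
    fun i => (hint.subordinateOrthonormalBasisIndex hn i hfam).1.2,
    fun i => (hint.subordinateOrthonormalBasisIndex hn i hfam).1.1, fun i => ?_⟩
  obtain ⟨h1, h2⟩ := hint.subordinateOrthonormalBasis_subordinate hn i hfam
  exact ⟨Module.End.mem_eigenspace_iff.mp h1, Module.End.mem_eigenspace_iff.mp h2⟩

/-- The **spectral theorem** for normal matrices. -/
lemma exists_unitary_diagonalization_of_normal {n : ℕ} (B : Matrix (Fin n) (Fin n) ℂ)
    (hB : B * Bᴴ = Bᴴ * B) :
    ∃ (U : Matrix (Fin n) (Fin n) ℂ) (d : Fin n → ℂ),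
      Uᴴ * U = 1 ∧ U * Uᴴ = 1 ∧ B = U * diagonal d * Uᴴ := by
  set H := B + Bᴴ with hH
  set L := Complex.I • (B - Bᴴ) with hL
  have hHs : (toEuclideanLin H).IsSymmetric :=
    isSymmetric_toEuclideanLin_iff.mpr (by simp [IsHermitian, hH, add_comm])
  have hLs : (toEuclideanLin L).IsSymmetric :=
    isSymmetric_toEuclideanLin_iff.mpr (by
      simp [IsHermitian, hL, conjTranspose_smul, ← smul_neg])
  have hcomm : Commute (toEuclideanLin H) (toEuclideanLin L) := by
    have h : H * L = L * H := by
      simp only [hH, hL, mul_smul_comm, smul_mul_assoc]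
      congr 1
      simp only [add_mul, mul_sub, sub_mul, mul_add, hB]
      abel
    refine LinearMap.ext fun x => ?_
    simp [toLpLin_apply, h]
  obtain ⟨b, x, y, hb⟩ :=
    exists_orthonormalBasis_of_commute finrank_euclideanSpace_fin hHs hLs hcomm
  set U : Matrix (Fin n) (Fin n) ℂ := of fun l i => b i l with hU
  set d : Fin n → ℂ := fun a => (x a - Complex.I * y a) / 2 with hd
  have hUU : Uᴴ * U = 1 := by
    ext i j
    have h := orthonormal_iff_ite.mp b.orthonormal i j
    simp only [PiLp.inner_apply, RCLike.inner_apply] at h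
    rw [mul_apply, one_apply, ← h]
    exact Finset.sum_congr rfl fun l _ => mul_comm _ _
  have hUU' : U * Uᴴ = 1 := mul_eq_one_comm.mp hUU
  refine ⟨U, d, hUU, hUU', ?_⟩
  have hBU : B * U = U * diagonal d := by
    ext l a
    obtain ⟨h1, h2⟩ := hb a
    have h1' := congrArg (fun x => x l) h1
    have h2' := congrArg (fun x => x l) h2
    simp only [toLpLin_apply, hH, hL, mulVec, dotProduct, Matrix.add_apply,
      Matrix.smul_apply, Matrix.sub_apply, PiLp.smul_apply, smul_eq_mul, add_mul, sub_mul, mul_sub,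
      mul_assoc, Finset.sum_add_distrib, Finset.sum_sub_distrib, ← Finset.mul_sum] at h1' h2'
    rw [mul_apply, mul_diagonal]
    simp only [hU, hd, of_apply]
    linear_combination (h1' - Complex.I * h2') / 2
      + (∑ x, B l x * (b a).ofLp x - ∑ x, Bᴴ l x * (b a).ofLp x) * Complex.I_sq / 2
  rw [← hBU, Matrix.mul_assoc, hUU', Matrix.mul_one]

lemma card_nonneg_eigenvalues_of_unitary_diagonalization {n : ℕ} (U H : Matrix (Fin n) (Fin n) ℂ)
    (r : Fin n → ℝ) (hU : Uᴴ * U = 1) (hH : H = U * diagonal (fun i => (r i : ℂ)) * Uᴴ) :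
    numNonnegEig H = (Finset.univ.filter fun i => 0 ≤ r i).card := by
  have hherm : H.IsHermitian := by
    rw [hH, IsHermitian, conjTranspose_mul, conjTranspose_mul, conjTranspose_conjTranspose,
      diagonal_conjTranspose, Matrix.mul_assoc]
    congr 3
    ext i
    simp
  have hroots : H.charpoly.roots = Multiset.map (fun i => (r i : ℂ)) Finset.univ.val := by
    rw [hH, charpoly_mul_comm, ← Matrix.mul_assoc, hU, Matrix.one_mul, charpoly_diagonal]
    exact Polynomial.roots_multiset_prod_X_sub_C
      (Multiset.map (fun i => (r i : ℂ)) Finset.univ.val) ▸ by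
        rw [Multiset.map_map]; rfl
  have h := congrArg (Multiset.map Complex.re)
    (hherm.roots_charpoly_eq_eigenvalues.symm.trans hroots)
  have hcount := congrArg (Multiset.countP (0 ≤ ·)) h
  rw [Multiset.map_map, Multiset.map_map, Multiset.countP_map, Multiset.countP_map] at hcount
  rw [numNonnegEig, dif_pos hherm]
  exact hcount

/-- The number of `i` with `lam i` in the closed half-plane `0 ≤ re (z * ·)`. -/
noncomputable def halfPlaneCount {ι : Type*} [Fintype ι] (lam : ι → ℂ) (z : ℂ) : ℕ :=
  (Finset.univ.filter fun i => 0 ≤ (z * lam i).re).card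

/-- Some half-plane containing the fewest points has no point on its boundary. -/
lemma exists_halfPlaneCount_minimal {ι : Type*} [Fintype ι] (lam : ι → ℂ) (hlam : ∀ i, lam i ≠ 0) :
    ∃ z : ℂ, z ≠ 0 ∧ (∀ i, (z * lam i).re ≠ 0) ∧
      ∀ w : ℂ, w ≠ 0 → halfPlaneCount lam z ≤ halfPlaneCount lam w := by
  obtain ⟨z, hz, hmin⟩ := (measure (halfPlaneCount lam)).wf.has_min {z | z ≠ 0} ⟨1, one_ne_zero⟩
  have hmin' (w : ℂ) (hw : w ≠ 0) : halfPlaneCount lam z ≤ halfPlaneCount lam w :=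
    not_lt.mp (hmin w hw)
  have hre (δ : ℝ) (i : ι) : (z * (1 + δ * Complex.I) * lam i).re
      = (z * lam i).re - δ * (z * lam i).im := by
    rw [show z * (1 + δ * Complex.I) * lam i = z * lam i + δ * (Complex.I * (z * lam i)) by ring]
    simp only [Complex.add_re, Complex.re_ofReal_mul, Complex.I_mul_re]
    ring
  have hev : ∀ᶠ δ : ℝ in nhdsWithin 0 (Set.Ioi 0), ∀ i,
      (z * (1 + δ * Complex.I) * lam i).re ≠ 0 ∧
        ((z * lam i).re < 0 → (z * (1 + δ * Complex.I) * lam i).re < 0) := by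
    refine Filter.eventually_all.mpr fun i => ?_
    simp only [hre]
    have hcont : Filter.Tendsto (fun δ : ℝ => (z * lam i).re - δ * (z * lam i).im)
        (nhdsWithin 0 (Set.Ioi 0)) (nhds (z * lam i).re) := by
      have : Continuous (fun δ : ℝ => (z * lam i).re - δ * (z * lam i).im) := by fun_prop
      simpa using (this.tendsto 0).mono_left nhdsWithin_le_nhds
    rcases lt_trichotomy (z * lam i).re 0 with h | h | h
    · filter_upwards [hcont.eventually_lt_const h] with δ hδ
      exact ⟨hδ.ne, fun _ => hδ⟩
    · have him : (z * lam i).im ≠ 0 := fun h' =>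
        mul_ne_zero hz (hlam i) (Complex.ext h h')
      filter_upwards [self_mem_nhdsWithin] with δ hδ
      refine ⟨?_, fun h' => absurd h h'.ne⟩
      rw [h, zero_sub]
      exact neg_ne_zero.mpr (mul_ne_zero (ne_of_gt hδ) him)
    · filter_upwards [hcont.eventually_const_lt h] with δ hδ
      exact ⟨hδ.ne', fun h' => absurd h h'.not_gt⟩
  obtain ⟨δ, hδ⟩ := hev.exists
  have hne : (1 + δ * Complex.I : ℂ) ≠ 0 := fun h => by simpa using congrArg Complex.re h
  refine ⟨z * (1 + δ * Complex.I), mul_ne_zero hz hne, fun i => (hδ i).1, fun w hw =>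
    le_trans (Finset.card_le_card fun i => ?_) (hmin' w hw)⟩
  simp only [Finset.mem_filter, Finset.mem_univ, true_and]
  exact fun h => not_lt.mp fun hlt => h.not_gt ((hδ i).2 hlt)

/-- A finite set can be enumerated along increasing values of `t`. -/
lemma exists_monotone_enumeration {ι : Type*} {m : ℕ} (s : Finset ι) (hs : s.card = m)
    (t : ι → ℝ) :
    ∃ p : Fin m → ι, Function.Injective p ∧ (∀ i, p i ∈ s) ∧ Monotone (t ∘ p) ∧
      ∀ Q : ι → Prop, ∀ [DecidablePred Q],
        (Finset.univ.filter fun i => Q (p i)).card = (s.filter Q).card := by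
  subst hs
  set e := s.equivFin.symm
  set σ := Tuple.sort (fun i => t (e i))
  have hinj : Function.Injective fun i => (e (σ i) : ι) :=
    Subtype.val_injective.comp (e.injective.comp σ.injective)
  refine ⟨fun i => e (σ i), hinj, fun i => (e (σ i)).2,
    Tuple.monotone_sort (fun i => t (e i)), fun Q _ => ?_⟩
  refine Finset.card_nbij (fun i => (e (σ i) : ι)) (fun i hi => ?_) hinj.injOn fun x hx => ?_
  · simp only [Finset.coe_filter, Finset.mem_univ, true_and, Set.mem_ofPred_eq] at hi ⊢
    exact ⟨(e (σ i)).2, hi⟩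
  · simp only [Finset.coe_filter, Set.mem_ofPred_eq] at hx
    have h : (e (σ (σ.symm (e.symm ⟨x, hx.1⟩))) : ι) = x := by simp
    refine ⟨σ.symm (e.symm ⟨x, hx.1⟩), ?_, h⟩
    simp only [Finset.coe_filter, Finset.mem_univ, true_and, Set.mem_ofPred_eq, h]
    exact hx.2

lemma card_filter_le_card_filter_lt {ι : Type*} (s s' : Finset ι) (t : ι → ℝ)
    (hne : ∀ i ∈ s, ∀ j ∈ s', t i ≠ t j)
    (h : ∀ c, s.card ≤ (s.filter fun i => c ≤ t i).card + (s'.filter fun i => t i ≤ c).card)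
    {j : ι} (hj : j ∈ s) :
    (s.filter fun i => t i ≤ t j).card ≤ (s'.filter fun i => t i < t j).card := by
  have hev : ∀ᶠ c in nhdsWithin (t j) (Set.Ioi (t j)), ∀ i ∈ s', t i ≤ c → t i ≤ t j := by
    refine (Filter.eventually_all_finset s').mpr fun i _ => ?_
    rcases le_or_gt (t i) (t j) with hi | hi
    · exact Filter.Eventually.of_forall fun _ _ => hi
    · filter_upwards [nhdsWithin_le_nhds (eventually_lt_nhds hi)] with c hc hc'
      exact absurd hc' hc.not_ge
  obtain ⟨c, hc, hjc : t j < c⟩ := (hev.and self_mem_nhdsWithin).exists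
  have h1 : (s.filter fun i => t i ≤ t j).card ≤ (s.filter fun i => ¬ c ≤ t i).card :=
    Finset.card_le_card fun i => by
      simp only [Finset.mem_filter]
      exact fun hi => ⟨hi.1, fun h' => (h'.trans hi.2).not_gt hjc⟩
  have h2 : (s'.filter fun i => t i ≤ c).card ≤ (s'.filter fun i => t i < t j).card :=
    Finset.card_le_card fun i => by
      simp only [Finset.mem_filter]
      exact fun hi => ⟨hi.1, (hc i hi.1 hi.2).lt_of_ne (hne j hj i hi.1).symm⟩
  have h3 := Finset.card_filter_add_card_filter_not (s := s) (fun i => c ≤ t i)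
  have h4 := h c
  omega

lemma conjTranspose_submatrix_one_mul_diagonal_mul {ι κ κ' : Type*} [Fintype ι] [DecidableEq ι]
    (p : κ → ι) (q : κ' → ι) (c : ι → ℂ) :
    ((1 : Matrix ι ι ℂ).submatrix id p)ᴴ * diagonal c * (1 : Matrix ι ι ℂ).submatrix id q
      = of fun i j => if p i = q j then c (p i) else 0 := by
  ext i j
  rw [mul_apply]
  simp only [mul_diagonal, conjTranspose_apply, submatrix_apply, id, one_apply, of_apply]
  rw [Finset.sum_eq_single (p i)]
  · simp
  · intro x _ hx
    simp [hx]
  · simp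

lemma exists_isotropic_of_halfPlaneCount_minimal {n N : ℕ} (mu : Fin n → ℂ)
    (hre : ∀ i, (mu i).re ≠ 0)
    (hne : ∀ i j, 0 < (mu i).re → (mu j).re < 0 →
      (mu i).im / (mu i).re ≠ (mu j).im / (mu j).re)
    (hN : (Finset.univ.filter fun i => 0 < (mu i).re).card = N)
    (hmin : ∀ z : ℂ, z ≠ 0 → N ≤ halfPlaneCount mu z) :
    ∃ Y : Matrix (Fin n) (Fin N) ℂ, Yᴴ * Y = 1 ∧
      Yᴴ * diagonal (fun i => mu i / (|(mu i).re| : ℝ)) * Y = 0 := by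
  set s := Finset.univ.filter fun i => 0 < (mu i).re with hs
  set s' := Finset.univ.filter fun i => (mu i).re < 0 with hs'
  set t : Fin n → ℝ := fun i => (mu i).im / (mu i).re with ht
  have him (i) : (mu i).im = t i * (mu i).re := (div_mul_cancel₀ _ (hre i)).symm
  have hne' : ∀ i ∈ s, ∀ j ∈ s', t i ≠ t j := fun i hi j hj =>
    hne i j (Finset.mem_filter.mp hi).2 (Finset.mem_filter.mp hj).2
  have hss : Finset.univ = s ∪ s' := by
    ext i
    simpa [hs, hs'] using (hre i).lt_or_gt.symm
  have hdisj : Disjoint s s' := Finset.disjoint_filter.mpr fun i _ h => h.not_gt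
  have hcount (z : ℂ) : halfPlaneCount mu z
      = (s.filter fun i => 0 ≤ (z * mu i).re).card
        + (s'.filter fun i => 0 ≤ (z * mu i).re).card := by
    rw [halfPlaneCount, hss, Finset.filter_union,
      Finset.card_union_of_disjoint (Finset.disjoint_filter_filter hdisj)]
  have hside (u : Fin n → ℝ) (z : ℂ) (hz : z ≠ 0) (c : ℝ)
      (h : ∀ i, (z * mu i).re = (mu i).re * (u i - c)) :
      s.card ≤ (s.filter fun i => c ≤ u i).card + (s'.filter fun i => u i ≤ c).card := by
    have hz' := hmin z hz
    rw [hcount, ← hN] at hz'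
    refine hz'.trans (add_le_add (Finset.card_le_card fun i => ?_)
      (Finset.card_le_card fun i => ?_)) <;>
      simp only [Finset.mem_filter, h] <;> rintro ⟨hi, hi'⟩
    · exact ⟨hi, sub_nonneg.mp ((mul_nonneg_iff_of_pos_left (Finset.mem_filter.mp hi).2).mp hi')⟩
    · exact ⟨hi, sub_nonpos.mp (nonpos_of_mul_nonneg_right hi' (Finset.mem_filter.mp hi).2)⟩
  have hlt (j) (hj : j ∈ s) := card_filter_le_card_filter_lt s s' t hne' (fun c =>
    hside t (-(c + Complex.I)) (fun h => by simpa using congrArg Complex.im h) c fun i => by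
      simp [him]; ring) hj
  have hgt (j) (hj : j ∈ s) := card_filter_le_card_filter_lt s s' (fun i => -t i)
    (fun i hi j hj h => hne' i hi j hj (neg_injective h)) (fun c =>
    hside (fun i => -t i) (-c + Complex.I) (fun h => by simpa using congrArg Complex.im h) c
      fun i => by simp [him]; ring) hj
  simp only [neg_le_neg_iff, neg_lt_neg_iff] at hgt
  obtain ⟨q, hq, hqs, hqt, hqc⟩ := exists_monotone_enumeration s hN t
  have hNs' : N ≤ s'.card := by
    rcases Nat.eq_zero_or_pos N with h0 | hpos
    · omega
    · have h1 := (Tuple.lt_card_le_iff_apply_le_of_monotone (j := ⟨N - 1, by omega⟩) hqt).mpr le_rfl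
      have h2 := hlt _ (hqs ⟨N - 1, by omega⟩)
      have h3 := Finset.card_filter_le s' fun i => t i < t (q ⟨N - 1, by omega⟩)
      simp only [Function.comp_apply] at h1
      rw [hqc (fun i => t i ≤ t (q ⟨N - 1, by omega⟩))] at h1
      omega
  obtain ⟨d, hd⟩ := Nat.exists_eq_add_of_le hNs'
  obtain ⟨p, hp, hps, hpt, hpc⟩ := exists_monotone_enumeration s' hd t
  obtain ⟨X, hX, hXt⟩ := exists_compression_of_interlacing_add (a := t ∘ p) (b := t ∘ q)
    (fun j => by
      have h1 := (Tuple.lt_card_le_iff_apply_le_of_monotone (j := j) hqt).mpr le_rfl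
      have h2 := hlt _ (hqs j)
      simp only [Function.comp_apply] at h1
      rw [hqc (fun i => t i ≤ t (q j))] at h1
      rw [← hpc (fun i => t i < t (q j))] at h2
      exact (Tuple.lt_card_lt_iff_apply_lt_of_monotone (j := j.castAdd d) hpt).mp
        (h1.trans_le h2))
    (fun j => by
      have h1 := (Tuple.lt_card_lt_iff_apply_lt_of_monotone (j := j) (a := t (q j)) hqt).not.mpr
        (lt_irrefl _)
      have h2 := hgt _ (hqs j)
      have h3 := Finset.card_filter_add_card_filter_not (s := s) (fun i => t i < t (q j))
      have h4 := Finset.card_filter_add_card_filter_not (s := s') (fun i => t i ≤ t (q j))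
      simp only [Function.comp_apply] at h1
      rw [hqc (fun i => t i < t (q j))] at h1
      simp only [not_lt] at h3
      simp only [not_le] at h4
      rw [← hpc (fun i => t i ≤ t (q j))] at h4
      refine not_le.mp ((Tuple.lt_card_le_iff_apply_le_of_monotone (j := j.addNat d) hpt).not.mp ?_)
      simp only [Function.comp_apply, Fin.val_addNat]
      omega)
  set C : Matrix (Fin (N + d)) (Fin N) ℂ := X.map Complex.ofRealHom with hC
  have hCt : Cᴴ = Xᵀ.map Complex.ofRealHom := by
    ext i j
    simp [hC]
  have hCC : Cᴴ * C = 1 := by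
    rw [hCt, hC, ← Matrix.map_mul, hX, Matrix.map_one _ (map_zero _) (map_one _)]
  have hCtC : Cᴴ * diagonal (fun i => (t (p i) : ℂ)) * C = diagonal fun j => (t (q j) : ℂ) := by
    have h := congrArg (fun M => M.map Complex.ofRealHom) hXt
    simp only [Matrix.map_mul, diagonal_map (map_zero Complex.ofRealHom)] at h
    rw [hCt]
    exact h
  set E := (1 : Matrix (Fin n) (Fin n) ℂ).submatrix id p with hE
  set F := (1 : Matrix (Fin n) (Fin n) ℂ).submatrix id q with hF
  have hpq (i j) : p i ≠ q j := fun h => Finset.disjoint_left.mp hdisj (hqs j) (h ▸ hps i)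
  have hform (c : Fin n → ℂ) : (E * C + F)ᴴ * diagonal c * (E * C + F)
      = Cᴴ * diagonal (c ∘ p) * C + diagonal (c ∘ q) := by
    have h1 : Eᴴ * diagonal c * E = diagonal (c ∘ p) := by
      rw [conjTranspose_submatrix_one_mul_diagonal_mul]
      ext i j
      simp [diagonal_apply, hp.eq_iff]
    have h2 : Fᴴ * diagonal c * F = diagonal (c ∘ q) := by
      rw [conjTranspose_submatrix_one_mul_diagonal_mul]
      ext i j
      simp [diagonal_apply, hq.eq_iff]
    have h3 : Eᴴ * diagonal c * F = 0 := by
      rw [conjTranspose_submatrix_one_mul_diagonal_mul]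
      ext i j
      simp [hpq]
    have h4 : Fᴴ * diagonal c * E = 0 := by
      rw [conjTranspose_submatrix_one_mul_diagonal_mul]
      ext i j
      simp [(hpq _ _).symm]
    calc _ = Cᴴ * (Eᴴ * diagonal c * E) * C + Cᴴ * (Eᴴ * diagonal c * F)
          + (Fᴴ * diagonal c * E) * C + Fᴴ * diagonal c * F := by
          simp only [conjTranspose_add, conjTranspose_mul, Matrix.add_mul, Matrix.mul_add,
            Matrix.mul_assoc]
          abel
      _ = _ := by rw [h1, h2, h3, h4, Matrix.mul_zero, Matrix.zero_mul, add_zero, add_zero]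
  have hscale (M : Matrix (Fin n) (Fin n) ℂ) :
      (((√2 : ℝ) : ℂ)⁻¹ • (E * C + F))ᴴ * M * (((√2 : ℝ) : ℂ)⁻¹ • (E * C + F))
        = (2 : ℂ)⁻¹ • ((E * C + F)ᴴ * M * (E * C + F)) := by
    have h2 : ((√2 : ℝ) : ℂ)⁻¹ * ((√2 : ℝ) : ℂ)⁻¹ = 2⁻¹ := by
      rw [← mul_inv, ← Complex.ofReal_mul, Real.mul_self_sqrt (by norm_num)]
      norm_num
    simp only [conjTranspose_smul, Matrix.smul_mul, Matrix.mul_smul, smul_smul, star_inv₀,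
      Complex.star_def, Complex.conj_ofReal, h2]
  refine ⟨((√2 : ℝ) : ℂ)⁻¹ • (E * C + F), ?_, ?_⟩
  · have h := hform 1
    have h1 (m : ℕ) : diagonal (1 : Fin m → ℂ) = 1 := diagonal_one
    rw [Pi.one_comp, Pi.one_comp, h1, h1, h1, Matrix.mul_one, Matrix.mul_one, hCC] at h
    have h' := hscale 1
    rw [Matrix.mul_one, Matrix.mul_one] at h'
    rw [h', h, ← two_smul ℂ, smul_smul]
    norm_num
  · rw [hscale, hform]
    have hmu (i) : mu i = (mu i).re * (1 + Complex.I * t i) := by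
      apply Complex.ext <;> simp [him]
      ring
    have hp' : (fun i => mu i / ((|(mu i).re| : ℝ) : ℂ)) ∘ p
        = fun i => -(1 + Complex.I * t (p i)) := by
      ext i
      have hneg : (mu (p i)).re < 0 := (Finset.mem_filter.mp (hps i)).2
      have h0 : ((mu (p i)).re : ℂ) ≠ 0 := by exact_mod_cast hneg.ne
      simp only [Function.comp_apply]
      rw [abs_of_neg hneg, Complex.ofReal_neg, div_neg, neg_inj, div_eq_iff h0, mul_comm]
      exact hmu _
    have hq' : (fun i => mu i / ((|(mu i).re| : ℝ) : ℂ)) ∘ q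
        = fun i => 1 + Complex.I * t (q i) := by
      ext i
      have hpos : 0 < (mu (q i)).re := (Finset.mem_filter.mp (hqs i)).2
      have h0 : ((mu (q i)).re : ℂ) ≠ 0 := by exact_mod_cast hpos.ne'
      simp only [Function.comp_apply]
      rw [abs_of_pos hpos, div_eq_iff h0, mul_comm]
      exact hmu _
    have hdiag {m : ℕ} (u : Fin m → ℂ) : diagonal (fun i => 1 + Complex.I * u i)
        = 1 + Complex.I • diagonal u := by
      rw [← diagonal_one, ← diagonal_smul, diagonal_add]
      rfl
    rw [hp', hq', show diagonal (fun i => -(1 + Complex.I * (t (p i) : ℂ)))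
        = -diagonal (fun i => 1 + Complex.I * (t (p i) : ℂ)) from (diagonal_neg _).symm,
       hdiag (fun i => (t (p i) : ℂ)),
      hdiag (fun i => (t (q i) : ℂ)), Matrix.mul_neg, Matrix.neg_mul, Matrix.mul_add,
      Matrix.add_mul, Matrix.mul_one, hCC, Matrix.mul_smul, Matrix.smul_mul, hCtC,
      neg_add_cancel, smul_zero]

lemma mem_spectrum_of_eq_unitary_conj {n : ℕ} {B U : Matrix (Fin n) (Fin n) ℂ}
    {lam : Fin n → ℂ} (hU : Uᴴ * U = 1) (hU' : U * Uᴴ = 1) (hB : B = U * diagonal lam * Uᴴ)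
    (i : Fin n) : lam i ∈ spectrum ℂ B := by
  have h : spectrum ℂ (U * diagonal lam * Uᴴ) = spectrum ℂ (diagonal lam) :=
    spectrum.units_conjugate (u := ⟨U, Uᴴ, hU', hU⟩)
  rw [hB, h, spectrum_diagonal]
  exact ⟨i, rfl⟩

lemma le_halfPlaneCount_of_le_numNonnegEig {n k : ℕ} {B U : Matrix (Fin n) (Fin n) ℂ}
    {lam : Fin n → ℂ} (hU : Uᴴ * U = 1) (hB : B = U * diagonal lam * Uᴴ)
    (hk : ∀ ξ ∈ Set.Ico (0 : ℝ) (2 * Real.pi),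
      k ≤ numNonnegEig (Complex.exp (ξ * Complex.I) • B
        + Complex.exp (-(ξ * Complex.I)) • Bᴴ))
    {w : ℂ} (hw : w ≠ 0) : k ≤ halfPlaneCount lam w := by
  obtain ⟨ξ, hξ, hwξ⟩ : ∃ ξ ∈ Set.Ico (0 : ℝ) (2 * Real.pi),
      w = (‖w‖ : ℝ) * Complex.exp (ξ * Complex.I) := by
    refine ⟨toIcoMod Real.two_pi_pos 0 w.arg,
      by simpa using toIcoMod_mem_Ico Real.two_pi_pos 0 w.arg, ?_⟩
    rw [toIcoMod, Complex.ofReal_sub, sub_mul, zsmul_eq_mul, Complex.ofReal_mul,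
      Complex.ofReal_intCast, Complex.ofReal_mul, Complex.ofReal_ofNat, mul_assoc,
      Complex.exp_sub, Complex.exp_int_mul_two_pi_mul_I, div_one, Complex.norm_mul_exp_arg_mul_I]
  have hstar : Complex.exp (-(ξ * Complex.I)) = star (Complex.exp (ξ * Complex.I)) := by
    rw [Complex.star_def, ← Complex.exp_conj]
    simp
  have h := hk ξ hξ
  rw [hstar, card_nonneg_eigenvalues_of_unitary_diagonalization U _
    (fun i => 2 * (Complex.exp (ξ * Complex.I) * lam i).re) hU] at h
  · refine h.trans_eq (congrArg Finset.card (Finset.filter_congr fun i _ => ?_))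
    rw [hwξ, mul_assoc, Complex.re_ofReal_mul, mul_nonneg_iff_of_pos_left two_pos,
      mul_nonneg_iff_of_pos_left]
    simpa [← hwξ] using hw
  · have hd : diagonal (fun i => ((2 * (Complex.exp (ξ * Complex.I) * lam i).re : ℝ) : ℂ))
        = Complex.exp (ξ * Complex.I) • diagonal lam
          + star (Complex.exp (ξ * Complex.I)) • (diagonal lam)ᴴ := by
      rw [diagonal_conjTranspose, ← diagonal_smul, ← diagonal_smul, diagonal_add]
      congr 1
      ext i
      rw [← Complex.add_conj, map_mul]
      rfl
    rw [hd, hB]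
    simp only [conjTranspose_mul, conjTranspose_conjTranspose, Matrix.mul_add, Matrix.add_mul,
      Matrix.mul_smul, Matrix.smul_mul, Matrix.mul_assoc]

/-- If `B` is an invertible normal matrix, no two eigenvalues of `B` point in opposite
directions (no eigenvalue is a positive multiple of the negative of another), and for every
`ξ ∈ [0, 2π)` the Hermitian matrix `e^{iξ}B + e^{-iξ}B*` has at least `k` nonnegative
eigenvalues, then some *congruence `S*BS` of `B` has `0_k` as its leading principal
`k × k` submatrix. -/
theorem exists_congruence_zero_leading_block {n k : ℕ} (B : Matrix (Fin n) (Fin n) ℂ)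
    (hnormal : B * Bᴴ = Bᴴ * B) (hinv : IsUnit B)
    (hargs : ∀ lam ∈ spectrum ℂ B, ∀ mu ∈ spectrum ℂ B,
      ∀ t : ℝ, 0 < t → lam ≠ -((t : ℂ) * mu))
    (hk : ∀ ξ ∈ Set.Ico (0 : ℝ) (2 * Real.pi),
      k ≤ numNonnegEig (Complex.exp (ξ * Complex.I) • B
        + Complex.exp (-(ξ * Complex.I)) • Bᴴ)) :
    ∃ S : Matrix (Fin n) (Fin n) ℂ, IsUnit S ∧
      ∀ i j : Fin n, (i : ℕ) < k → (j : ℕ) < k → (Sᴴ * B * S) i j = 0 := by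
  obtain ⟨U, lam, hU, hU', hB⟩ := exists_unitary_diagonalization_of_normal B hnormal
  have hspec := mem_spectrum_of_eq_unitary_conj hU hU' hB
  have hlam (i) : lam i ≠ 0 := fun h =>
    spectrum.zero_notMem (R := ℂ) hinv (h ▸ hspec i)
  obtain ⟨z, hz, hre, hmin⟩ := exists_halfPlaneCount_minimal lam hlam
  have hkz : k ≤ halfPlaneCount lam z := le_halfPlaneCount_of_le_numNonnegEig hU hB hk hz
  obtain ⟨Y, hY, hYM⟩ := exists_isotropic_of_halfPlaneCount_minimal
    (N := halfPlaneCount lam z) (fun i => z * lam i) hre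
    (fun i j hi hj hij => by
      rw [div_eq_div_iff hi.ne' hj.ne] at hij
      have hj' : ((z * lam j).re : ℂ) ≠ 0 := by exact_mod_cast hj.ne
      refine hargs _ (hspec i) _ (hspec j) (-((z * lam i).re / (z * lam j).re))
        (neg_pos.mpr (div_neg_of_pos_of_neg hi hj)) ?_
      have h : z * lam i * (z * lam j).re = (z * lam i).re * (z * lam j) := by
        apply Complex.ext
        · rw [Complex.re_mul_ofReal, Complex.re_ofReal_mul]
        · rw [Complex.im_mul_ofReal, Complex.im_ofReal_mul, hij, mul_comm]
      have h' : lam i * (z * lam j).re = (z * lam i).re * lam j :=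
        mul_left_cancel₀ hz (by linear_combination h)
      rw [Complex.ofReal_neg, Complex.ofReal_div, neg_mul, neg_neg, div_mul_eq_mul_div,
        eq_div_iff hj', h'])
    (congrArg Finset.card (Finset.filter_congr fun i _ =>
      ⟨le_of_lt, fun h => h.lt_of_ne (hre i).symm⟩))
    (fun w hw => by
      refine (hmin (w * z) (mul_ne_zero hw hz)).trans_eq ?_
      simp only [halfPlaneCount, mul_assoc])
  obtain ⟨S, hS, hS0⟩ := exists_zero_leading_block_of_isotropic hkz _ Y hY hYM
  set D : Matrix (Fin n) (Fin n) ℂ :=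
    diagonal fun i => ((√|(z * lam i).re| : ℝ) : ℂ)⁻¹ with hD
  have hDunit : IsUnit D := by
    rw [hD, isUnit_diagonal, Pi.isUnit_iff]
    exact fun i => (inv_ne_zero (by simpa using hre i)).isUnit
  have hDlam : Dᴴ * diagonal lam * D
      = z⁻¹ • diagonal fun i => z * lam i / (|(z * lam i).re| : ℝ) := by
    rw [hD, diagonal_conjTranspose, diagonal_mul_diagonal, diagonal_mul_diagonal,
      ← diagonal_smul]
    congr 1
    ext i
    have h : ((√|(z * lam i).re| : ℝ) : ℂ) * (√|(z * lam i).re| : ℝ) = (|(z * lam i).re| : ℝ) := by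
      rw [← Complex.ofReal_mul, Real.mul_self_sqrt (abs_nonneg _)]
    simp only [Pi.star_apply, star_inv₀, Complex.star_def, Complex.conj_ofReal, Pi.smul_apply,
      smul_eq_mul]
    rw [← h]
    field_simp
  refine ⟨U * D * S, ((IsUnit.of_mul_eq_one _ hU').mul hDunit).mul hS, fun i j hi hj => ?_⟩
  have hfactor : (U * D * S)ᴴ * B * (U * D * S) = Sᴴ * (Dᴴ * diagonal lam * D) * S := by
    calc _ = Sᴴ * Dᴴ * (Uᴴ * U) * diagonal lam * (Uᴴ * U) * D * S := by
          rw [hB]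
          simp only [conjTranspose_mul, Matrix.mul_assoc]
      _ = _ := by simp only [hU, Matrix.mul_one, Matrix.mul_assoc]
  rw [hfactor, hDlam, Matrix.mul_smul, Matrix.smul_mul, Matrix.smul_apply, hS0 i j hi hj,
    smul_zero]
end
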